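/- Assume that for every cardinal λ > ℵ₁, every stationary family 𝒜 ⊆ [λ]^{ℵ₀} reflects in some set A ⊆ λ of cardinality ℵ₁. Then for every singular cardinal μ and every infinite cardinal κ < μ: if κ < cf(μ) then cf([μ]^{≤κ}, ⊆) = μ, and if cf(μ) ≤ κ then cf([μ]^{≤κ}, ⊆) = μ⁺; in particular, for every singular cardinal μ, cf([μ]^{≤cf(μ)}, ⊆) = μ⁺. -/

import Mathlib

open Cardinal Set

namespace ReflSCH

/-- `[B]^{<ℵ₁}`: the family of subsets of `B` of cardinality `< ℵ₁`,
i.e. the countable subsets of `B`. -/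
def small (B : Set Ordinal.{0}) : Set (Set Ordinal.{0}) := {a | a ⊆ B ∧ a.Countable}

/-- `[B]^{ℵ₀}`: the countably infinite subsets of `B`. -/
def ctblInf (B : Set Ordinal.{0}) : Set (Set Ordinal.{0}) :=
  {a | a ⊆ B ∧ a.Countable ∧ a.Infinite}

/-- A family is closed if the union of every nonempty `⊆`-increasing chain of fewer
than `ℵ₁` (i.e. countably many) of its members belongs to it. -/
def ClosedFam (𝒜 : Set (Set Ordinal.{0})) : Prop :=
  ∀ D : Set (Set Ordinal.{0}), D ⊆ 𝒜 → D.Nonempty → IsChain (· ⊆ ·) D → D.Countable →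
    ⋃₀ D ∈ 𝒜

/-- A family is unbounded in `[B]^{<ℵ₁}` if every member of `[B]^{<ℵ₁}` is contained in
some member of the family. -/
def UnbFam (B : Set Ordinal.{0}) (𝒜 : Set (Set Ordinal.{0})) : Prop :=
  ∀ y ∈ small B, ∃ x ∈ 𝒜, y ⊆ x

/-- A club of `[B]^{<ℵ₁}`. -/
def ClubFam (B : Set Ordinal.{0}) (𝒜 : Set (Set Ordinal.{0})) : Prop :=
  𝒜 ⊆ small B ∧ ClosedFam 𝒜 ∧ UnbFam B 𝒜

/-- The family `𝒜` meets every club of `[B]^{<ℵ₁}`. -/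
def MeetsClubs (B : Set Ordinal.{0}) (𝒜 : Set (Set Ordinal.{0})) : Prop :=
  ∀ 𝒞 : Set (Set Ordinal.{0}), ClubFam B 𝒞 → (𝒜 ∩ 𝒞).Nonempty

/-- Stationarity in `[B]^{<ℵ₁}`. -/
def StatFam (B : Set Ordinal.{0}) (𝒜 : Set (Set Ordinal.{0})) : Prop :=
  𝒜 ⊆ small B ∧ MeetsClubs B 𝒜

/-- `𝒜` reflects in `B₂` iff `𝒜 ∩ [B₂]^{ℵ₀}` is stationary in `[B₂]^{<ℵ₁}`. -/
def Reflects (𝒜 : Set (Set Ordinal.{0})) (B₂ : Set Ordinal.{0}) : Prop :=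
  StatFam B₂ (𝒜 ∩ ctblInf B₂)

/-- `f <_{J^{bd}_ω} g`: `f n < g n` for all but finitely many `n`. -/
def ltBd (f g : ℕ → Ordinal.{0}) : Prop := ∃ m : ℕ, ∀ n ≥ m, f n < g n

/-- `⟨f_α : α < lam.ord⟩` witnesses `lam = tcf (∏_n lamseq n, <_{J^{bd}_ω})`:
each `f_α ∈ ∏_n lamseq n`, the sequence is `<_{J^{bd}_ω}`-increasing, and it is
cofinal in the product. -/
def TcfWitness (lam : Cardinal.{0}) (lamseq : ℕ → Cardinal.{0})
    (f : Ordinal.{0} → ℕ → Ordinal.{0}) : Prop :=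
  (∀ α < lam.ord, ∀ n : ℕ, f α n < (lamseq n).ord) ∧
  (∀ α < lam.ord, ∀ β < lam.ord, α < β → ltBd (f α) (f β)) ∧
  (∀ g : ℕ → Ordinal.{0}, (∀ n : ℕ, g n < (lamseq n).ord) → ∃ α < lam.ord, ltBd g (f α))

/-- The sequence `⟨f_i : i ∈ I⟩` is free. -/
def Free (I : Set Ordinal.{0}) (f : Ordinal.{0} → ℕ → Ordinal.{0}) : Prop :=
  ∃ nf : Ordinal.{0} → ℕ, ∀ i ∈ I, ∀ j ∈ I, i < j →
    ∀ n : ℕ, nf i ≤ n → nf j ≤ n → f i n < f j n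

/-- `cf([μ]^{≤κ}, ⊆)`: the least cardinality of a family `F` of subsets of `μ` of
cardinality `≤ κ` such that every subset of `μ` of cardinality `≤ κ` is contained in
some member of `F`. -/
noncomputable def covCf (μ κ : Cardinal.{0}) : Cardinal.{1} :=
  sInf { c : Cardinal.{1} | ∃ F : Set (Set Ordinal.{0}),
    (∀ a ∈ F, a ⊆ Set.Iio μ.ord ∧ #a ≤ Cardinal.lift.{1,0} κ) ∧ #F = c ∧
    ∀ b : Set Ordinal.{0}, b ⊆ Set.Iio μ.ord → #b ≤ Cardinal.lift.{1,0} κ →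
      ∃ a ∈ F, b ⊆ a }

section
open Order


/-- least strict upper bound -/
noncomputable def ls (X : Set Ordinal.{0}) : Ordinal.{0} := sSup ((fun x => x + 1) '' X)

lemma lt_ls {X : Set Ordinal.{0}} [hs : Small.{0} X] {x : Ordinal.{0}} (hx : x ∈ X) : x < ls X := by
  have : x + 1 ≤ ls X := le_csSup Ordinal.bddAbove_of_small (mem_image_of_mem _ hx)
  exact lt_of_lt_of_le (lt_add_one x) this

lemma ls_le {X : Set Ordinal.{0}} {b : Ordinal.{0}} (h : ∀ x ∈ X, x < b) : ls X ≤ b := by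
  refine csSup_le' ?_
  rintro _ ⟨x, hx, rfl⟩
  exact Order.add_one_le_of_lt (h x hx)

lemma exists_of_lt_ls {X : Set Ordinal.{0}} {b : Ordinal.{0}} (h : b < ls X) : ∃ x ∈ X, b ≤ x := by
  by_contra hc
  push Not at hc
  exact absurd (ls_le hc) (not_le.mpr h)

lemma ls_lt_cof {X : Set Ordinal.{0}} {o : Ordinal.{0}} (h : #X < lift.{1,0} o.cof)
    (hX : ∀ x ∈ X, x < o) : ls X < o := by
  refine Ordinal.sSup_add_one_lt_of_lt_cof ?_ hX
  rwa [← Ordinal.lift_cof]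

lemma ls_lt {X : Set Ordinal.{0}} {c : Cardinal.{0}} (hc : c.IsRegular) (h : #X < lift.{1,0} c)
    (hX : ∀ x ∈ X, x < c.ord) : ls X < c.ord :=
  ls_lt_cof (by rwa [hc.cof_ord]) hX

lemma mk_Iio_lt {α : Ordinal.{0}} {c : Cardinal.{0}} (h : α < c.ord) :
    #(Iio α) < lift.{1,0} c := by
  rw [mk_Iio_ordinal, Cardinal.lift_lt]; exact lt_ord.mp h

lemma mk_img_le {α : Type 1} {β : Type 1} {F : α → β} {X : Set α} :
    #(F '' X) ≤ #X := mk_image_le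

lemma lsI_lt {F : Ordinal.{0} → Ordinal.{0}} {α : Ordinal.{0}} {c : Cardinal.{0}} (hc : c.IsRegular)
    (h : α < c.ord) (hF : ∀ x < α, F x < c.ord) : ls (F '' Iio α) < c.ord := by
  refine ls_lt hc (mk_image_le.trans_lt (mk_Iio_lt h)) ?_
  rintro _ ⟨x, hx, rfl⟩; exact hF x hx

lemma mk_range_lt {ι : Type} {β : Type 1} (f : ι → β) {c : Cardinal.{0}} (h : #ι < c) :
    #(range f) < lift.{1,0} c := by
  have := mk_range_le_lift (f := f)
  simp only [Cardinal.lift_id'.{0,1}] at this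
  refine lt_of_le_of_lt ?_ (Cardinal.lift_lt.{0,1}.mpr h)
  simpa using this

lemma lsr_lt {ι : Type} {f : ι → Ordinal.{0}} {c : Cardinal.{0}} (hc : c.IsRegular)
    (h : #ι < c) (hF : ∀ i, f i < c.ord) : ls (range f) < c.ord := by
  refine ls_lt hc (mk_range_lt f h) ?_
  rintro _ ⟨x, rfl⟩; exact hF x

lemma succ_lt_reg {c : Cardinal.{0}} (hc : ℵ₀ ≤ c) {x : Ordinal.{0}} (h : x < c.ord) :
    x + 1 < c.ord := (isSuccLimit_ord hc).add_one_lt h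

lemma small_of_lt {α : Type 1} {X : Set α} {c : Cardinal.{0}} (h : #X ≤ lift.{1,0} c) :
    Small.{0} X := by
  rw [small_iff_lift_mk_lt_univ]
  refine lt_of_le_of_lt (Cardinal.lift_le.mpr h) ?_
  simpa using Cardinal.lift_lt_univ'.{0,1} c

lemma exists_cof_seq (o : Ordinal.{0}) : ∃ e : Ordinal.{0} → Ordinal.{0},
    (∀ j < o.cof.ord, e j < o) ∧ (∀ j < o.cof.ord, ∀ i < j, e i < e j) ∧
    (∀ x < o, ∃ j < o.cof.ord, x ≤ e j) := by
  obtain ⟨f, hf⟩ := Ordinal.exists_isFundamentalSeq (o := o) rfl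
  classical
  refine ⟨fun j => if h : j < o.cof.ord then (f ⟨j, h⟩ : Ordinal) else 0, ?_, ?_, ?_⟩
  · intro j hj; simp only [hj, dif_pos]; exact (f ⟨j, hj⟩).2
  · intro j hj i hi
    simp only [hj, hi.trans hj, dif_pos]
    exact hf.strictMono (show (⟨i, hi.trans hj⟩ : Iio o.cof.ord) < ⟨j, hj⟩ from hi)
  · intro x hx
    obtain ⟨_, ⟨j, rfl⟩, hj⟩ := hf.isCofinal_range ⟨x, hx⟩
    refine ⟨j, j.2, ?_⟩
    have : (j : Ordinal) < o.cof.ord := j.2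
    simp only [this, dif_pos]; exact hj

lemma cof_le_of_cofinal {o : Ordinal.{0}} {X : Set Ordinal.{0}} (hX : ∀ x ∈ X, x < o)
    (h : ∀ x < o, ∃ y ∈ X, x ≤ y) : lift.{1,0} o.cof ≤ #X := by
  by_contra hc
  push Not at hc
  have h1 := ls_lt_cof hc hX
  obtain ⟨y, hy, h2⟩ := h _ h1
  have := small_of_lt hc.le
  exact absurd (lt_ls hy) (not_lt.mpr h2)

lemma cof_eq_of_seq {o a : Ordinal.{0}} (s : Ordinal.{0} → Ordinal.{0})
    (h1 : ∀ j < a, s j < o) (h2 : ∀ j < a, ∀ i < j, s i < s j)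
    (h3 : ∀ x < o, ∃ j < a, x ≤ s j) : o.cof = a.cof := by
  have := Ordinal.cof_iSup_Iio_add_one (f := fun j : Iio a => s j) (fun i j hij => h2 j j.2 i hij)
  rw [← this]; congr 1
  apply le_antisymm
  · by_contra hc; push Not at hc
    obtain ⟨j, hj, h⟩ := h3 _ hc
    have : s j + 1 ≤ ⨆ i : Iio a, s i + 1 := le_ciSup (f := fun i : Iio a => s i + 1) Ordinal.bddAbove_of_small ⟨j, hj⟩
    exact absurd (lt_of_lt_of_le (lt_add_one _) this) (not_lt.mpr h)
  · exact ciSup_le' fun i => Order.add_one_le_of_lt (h1 _ i.2)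

/-- `δ` is closed under `Φ` -/
def Cl (Φ : Ordinal.{0} → Ordinal.{0}) (δ : Ordinal.{0}) : Prop := ∀ x < δ, Φ x < δ

/-- continuous iteration -/
noncomputable def itr (Φ : Ordinal.{0} → Ordinal.{0}) (b : Ordinal.{0}) (j : Ordinal.{0}) : Ordinal.{0} :=
  max b (sSup (range fun i : Iio j => Φ (itr Φ b i)))
termination_by j
decreasing_by exact i.2

lemma itr_base {Φ b j} : b ≤ itr Φ b j := by rw [itr]; exact le_max_left _ _
lemma itr_step {Φ b j i} (h : i < j) : Φ (itr Φ b i) ≤ itr Φ b j := by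
  conv_rhs => rw [itr]
  refine le_max_of_le_right (le_csSup Ordinal.bddAbove_of_small ⟨⟨i, h⟩, rfl⟩)
lemma itr_le {Φ b j y} (hb : b ≤ y) (h : ∀ i < j, Φ (itr Φ b i) ≤ y) : itr Φ b j ≤ y := by
  rw [itr]; refine max_le hb (csSup_le' ?_)
  rintro _ ⟨i, rfl⟩; exact h i i.2
lemma itr_zero {Φ b} : itr Φ b 0 = b :=
  le_antisymm (itr_le le_rfl (by simp)) itr_base
lemma lt_itr {Φ b j y} (hb : b ≤ y) (h : y < itr Φ b j) : ∃ i < j, y < Φ (itr Φ b i) := by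
  by_contra hc; push Not at hc
  exact absurd (itr_le hb hc) (not_le.mpr h)
lemma itr_mono {Φ : Ordinal.{0} → Ordinal.{0}} {b i j} (h : i ≤ j) : itr Φ b i ≤ itr Φ b j :=
  itr_le itr_base fun _ hk => itr_step (hk.trans_le h)
lemma itr_strict {Φ : Ordinal.{0} → Ordinal.{0}} {b i j} (hΦ : ∀ x, x < Φ x) (h : i < j) :
    itr Φ b i < itr Φ b j := (hΦ _).trans_le (itr_step h)
lemma itr_lt {Φ : Ordinal.{0} → Ordinal.{0}} {c : Cardinal.{0}} (hc : c.IsRegular) {b} (hb : b < c.ord)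
    (hΦ : ∀ x < c.ord, Φ x < c.ord) {j} (hj : j < c.ord) : itr Φ b j < c.ord := by
  induction j using WellFoundedLT.induction with
  | ind j ih =>
    have : ls ((fun i => Φ (itr Φ b i)) '' Iio j) < c.ord :=
      lsI_lt hc hj fun x hx => hΦ _ (ih x hx (hx.trans hj))
    refine lt_of_le_of_lt (itr_le (le_max_left b _) fun i hi => le_max_of_le_right (lt_ls ?_).le) (max_lt hb this)
    exact ⟨i, hi, rfl⟩

/-- monotone majorant -/
noncomputable def maj (Φ : Ordinal.{0} → Ordinal.{0}) (x : Ordinal.{0}) : Ordinal.{0} :=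
  max (x + 1) (ls (Φ '' Iic x))
instance smallIic (x : Ordinal.{0}) : Small.{0} (Iic x) := by
  rw [← Iio_add_one_eq_Iic]; infer_instance
lemma lt_maj {Φ x} : x < maj Φ x := lt_of_lt_of_le (lt_add_one x) (le_max_left _ _)
lemma le_maj {Φ : Ordinal.{0} → Ordinal.{0}} {x y} (h : y ≤ x) : Φ y < maj Φ x :=
  lt_of_lt_of_le (lt_ls (X := Φ '' Iic x) ⟨y, h, rfl⟩) (le_max_right _ _)
lemma maj_mono {Φ : Ordinal.{0} → Ordinal.{0}} {x y} (h : y ≤ x) : maj Φ y ≤ maj Φ x := by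
  refine max_le (le_max_of_le_left (by gcongr)) (ls_le ?_)
  rintro _ ⟨z, hz, rfl⟩; exact le_maj (le_trans hz h)
lemma maj_lt {Φ : Ordinal.{0} → Ordinal.{0}} {c : Cardinal.{0}} (hc : c.IsRegular) 
    (hΦ : ∀ x < c.ord, Φ x < c.ord) {x} (hx : x < c.ord) : maj Φ x < c.ord := by
  have := succ_lt_reg hc.aleph0_le hx
  refine max_lt this ?_
  rw [← Iio_add_one_eq_Iic]
  exact lsI_lt hc this fun y hy => hΦ y (hy.trans this)

/-- closure points of prescribed cofinality -/
lemma exists_cl {Φ : Ordinal.{0} → Ordinal.{0}} {c ν : Cardinal.{0}} (hc : c.IsRegular)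
    (hΦ : ∀ x < c.ord, Φ x < c.ord) {b} (hb : b < c.ord) (hν : ν.IsRegular) (hνc : ν < c) :
    ∃ δ < c.ord, b < δ ∧ Cl Φ δ ∧ δ.cof = ν := by
  have hlim := isSuccLimit_ord hν.aleph0_le
  have hνo : ν.ord < c.ord := ord_lt_ord.mpr hνc
  have hpos : 0 < ν.ord := hν.ord_pos
  have key : ∀ x < itr (maj Φ) b ν.ord, ∃ j < ν.ord, x < itr (maj Φ) b j := by
    intro x hx
    rcases lt_or_ge x b with h | h
    · exact ⟨0, hpos, by rwa [itr_zero]⟩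
    · obtain ⟨i, hi, h⟩ := lt_itr h hx
      exact ⟨i + 1, hlim.add_one_lt hi, h.trans_le (itr_step (lt_add_one i))⟩
  refine ⟨itr (maj Φ) b ν.ord, itr_lt hc hb (fun x => maj_lt hc hΦ) hνo, ?_, ?_, ?_⟩
  · have := itr_strict (Φ := maj Φ) (b := b) (fun x => lt_maj) hpos
    rwa [itr_zero] at this
  · intro x hx
    obtain ⟨j, hj, h⟩ := key x hx
    exact (le_maj h.le).trans_le (itr_step hj)
  · rw [cof_eq_of_seq (a := ν.ord) (itr (maj Φ) b), hν.cof_ord]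
    · intro j hj; exact itr_strict (fun x => lt_maj) hj
    · intro j _ i hi; exact itr_strict (fun x => lt_maj) hi
    · intro x hx
      obtain ⟨j, hj, h⟩ := key x hx
      exact ⟨j, hj, h.le⟩


end

section
open Order

noncomputable def sg (G : Ordinal.{0} → Ordinal.{0}) (β : Ordinal.{0}) : Ordinal.{0} :=
  sSup {δ | δ ≤ β ∧ Cl G δ}
lemma sg_bdd {G : Ordinal.{0} → Ordinal.{0}} {β} : BddAbove {δ | δ ≤ β ∧ Cl G δ} := ⟨β, fun _ h => h.1⟩
lemma sg_le {G β} : sg G β ≤ β := csSup_le' fun _ h => h.1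
lemma le_sg {G β δ} (h : δ ≤ β) (h' : Cl G δ) : δ ≤ sg G β := le_csSup sg_bdd ⟨h, h'⟩
lemma cl_zero {G} : Cl G 0 := fun x hx => absurd hx (by simp)
lemma sg_cl {G β} : Cl G (sg G β) := by
  intro x hx
  obtain ⟨δ, hδ, h⟩ := exists_lt_of_lt_csSup (s := {δ | δ ≤ β ∧ Cl G δ}) ⟨0, by simp, cl_zero⟩ hx
  exact (hδ.2 x h).trans_le (le_sg hδ.1 hδ.2)
lemma cl_mono {G G' : Ordinal.{0} → Ordinal.{0}} (h : ∀ x, G x ≤ G' x) {δ} (hc : Cl G' δ) : Cl G δ :=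
  fun x hx => (h x).trans_lt (hc x hx)
lemma sg_anti {G G' : Ordinal.{0} → Ordinal.{0}} (h : ∀ x, G x ≤ G' x) {β} : sg G' β ≤ sg G β :=
  le_sg sg_le (cl_mono h sg_cl)

noncomputable def gseq (nx : (Ordinal.{0} → Ordinal.{0}) → (Ordinal.{0} → Ordinal.{0}))
    (ε : Ordinal.{0}) (x : Ordinal.{0}) : Ordinal.{0} :=
  sSup (range fun i : Iio ε => max (gseq nx i x) (nx (gseq nx i) x))
termination_by ε
decreasing_by all_goals exact i.2

lemma gseq_le {nx : (Ordinal.{0} → Ordinal.{0}) → (Ordinal.{0} → Ordinal.{0})} {i ε x} (h : i < ε) :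
    max (gseq nx i x) (nx (gseq nx i) x) ≤ gseq nx ε x := by
  conv_rhs => rw [gseq]
  exact le_csSup Ordinal.bddAbove_of_small ⟨⟨i, h⟩, rfl⟩

lemma gseq_lt {nx : (Ordinal.{0} → Ordinal.{0}) → (Ordinal.{0} → Ordinal.{0})} {c : Cardinal.{0}}
    (hc : c.IsRegular)
    (hnx : ∀ G, (∀ x < c.ord, G x < c.ord) → (∀ x < c.ord, nx G x < c.ord)) {ε} (hε : ε < c.ord) :
    ∀ x < c.ord, gseq nx ε x < c.ord := by
  induction ε using WellFoundedLT.induction with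
  | ind ε ih =>
    intro x hx
    have : ls ((fun i => max (gseq nx i x) (nx (gseq nx i) x)) '' Iio ε) < c.ord :=
      lsI_lt hc hε fun i hi => max_lt (ih i hi (hi.trans hε) x hx)
        (hnx _ (ih i hi (hi.trans hε)) x hx)
    refine lt_of_le_of_lt ?_ this
    rw [gseq]; refine csSup_le' ?_
    rintro _ ⟨i, rfl⟩; exact (lt_ls (X := (fun i => max (gseq nx i x) (nx (gseq nx i) x)) '' Iio ε) ⟨i, i.2, rfl⟩).le

lemma club_guess {ν τ : Cardinal.{0}} (hν : ν.IsRegular) (hτ : τ = succ (succ ν)) :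
    ∃ C : Ordinal.{0} → Set Ordinal.{0}, ∀ G : Ordinal.{0} → Ordinal.{0},
      (∀ x < τ.ord, G x < τ.ord) → ∃ α < τ.ord, α.cof = ν ∧ (∀ x ∈ C α, x < α ∧ x ≠ 0 ∧ Cl G x) ∧
        ∀ x < α, ∃ y ∈ C α, x < y := by
  have hν1 : (succ ν).IsRegular := isRegular_succ hν.aleph0_le
  have hτr : τ.IsRegular := hτ ▸ isRegular_succ hν1.aleph0_le
  have hντ : ν < τ := by rw [hτ]; exact (lt_succ ν).trans (lt_succ _)
  have hν1τ : succ ν < τ := by rw [hτ]; exact (lt_succ _)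
  choose e he1 he2 he3 using exists_cof_seq
  by_contra hcon
  push Not at hcon
  have hnx : ∀ Gs : Ordinal.{0} → Ordinal.{0}, ∃ G : Ordinal.{0} → Ordinal.{0},
      (∀ x < τ.ord, G x < τ.ord) ∧ 
      ∀ α < τ.ord, α.cof = ν → (∀ x < α, ∃ δ < α, x < δ ∧ Cl Gs δ) →
        ∃ j < ν.ord, ¬ Cl G (sg Gs (e α j)) := by
    intro Gs
    obtain ⟨G, hG, h⟩ := hcon fun α => {x | x ≠ 0 ∧ ∃ j < ν.ord, x = sg Gs (e α j)}
    refine ⟨G, hG, fun α hα hcof hlim => ?_⟩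
    by_contra hc; push Not at hc
    obtain ⟨x, hx, hx'⟩ := h α hα hcof (by
      rintro x ⟨hx0, j, hj, rfl⟩
      exact ⟨sg_le.trans_lt (he1 α j (hcof ▸ hj)), hx0, hc j hj⟩)
    obtain ⟨δ, hδ, hxδ, hcl⟩ := hlim x hx
    obtain ⟨j, hj, hj'⟩ := he3 α δ hδ
    rw [hcof] at hj
    have h2 := hxδ.trans_le (le_sg hj' hcl)
    exact absurd h2 (not_lt.mpr (hx' _ ⟨(bot_le.trans_lt h2).ne', j, hj, rfl⟩))
  choose nx hnx1 hnx2 using hnx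
  have hgood : ∀ ε < τ.ord, ∀ x < τ.ord, gseq nx ε x < τ.ord :=
    fun ε hε => gseq_lt hτr (fun G _ => hnx1 G) hε
  have hν1o : (succ ν).ord < τ.ord := ord_lt_ord.mpr hν1τ
  have hω : ℵ₀ < τ := hν.aleph0_le.trans_lt hντ
  have hcl : ∀ x, ∃ δ, x < τ.ord → δ < τ.ord ∧ x < δ ∧ Cl (gseq nx (succ ν).ord) δ := by
    intro x
    by_cases hx : x < τ.ord
    · obtain ⟨δ, h1, h2, h3, _⟩ := exists_cl hτr (hgood _ hν1o) hx isRegular_aleph0 hω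
      exact ⟨δ, fun _ => ⟨h1, h2, h3⟩⟩
    · exact ⟨0, fun h => absurd h hx⟩
  choose Φ hΦ using hcl
  obtain ⟨α, hα, -, hαcl, hαcof⟩ := exists_cl (Φ := Φ) hτr (fun x hx => (hΦ x hx).1)
    hτr.ord_pos hν hντ
  have hstab : ∀ β, ∃ ε < (succ ν).ord, ∀ ε' < (succ ν).ord, ε ≤ ε' →
      sg (gseq nx ε') β = sg (gseq nx ε) β := by
    intro β
    obtain ⟨ε, hε, hmin⟩ := exists_minimalFor_of_wellFoundedLT (fun ε => ε < (succ ν).ord)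
      (fun ε => sg (gseq nx ε) β) ⟨0, hν1.ord_pos⟩
    refine ⟨ε, hε, fun ε' hε' hle => le_antisymm ?_ (?_)⟩
    · rcases hle.eq_or_lt with rfl | h
      · rfl
      · exact sg_anti fun x => (le_max_left _ _).trans (gseq_le h)
    · rcases hle.eq_or_lt with rfl | h
      · rfl
      · exact hmin hε' (sg_anti fun x => (le_max_left _ _).trans (gseq_le h))
  choose εf hεf1 hεf2 using hstab
  set εs := ls ((fun j => εf (e α j)) '' Iio ν.ord) with hεs
  have hεslt : εs < (succ ν).ord := lsI_lt hν1 (ord_lt_ord.mpr (lt_succ ν)) fun j _ => hεf1 _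
  have hεs1 : εs + 1 < (succ ν).ord := succ_lt_reg hν1.aleph0_le hεslt
  obtain ⟨j, hj, hnot⟩ := hnx2 (gseq nx εs) α hα hαcof (fun x hx =>
    ⟨Φ x, hαcl x hx, (hΦ x (hx.trans hα)).2.1,
      cl_mono (fun y => (le_max_left _ _).trans (gseq_le hεslt)) (hΦ x (hx.trans hα)).2.2⟩)
  apply hnot
  have hlt : εf (e α j) < εs := lt_ls ⟨j, hj, rfl⟩
  rw [hεf2 _ _ hεslt hlt.le, ← hεf2 _ _ hεs1 (hlt.le.trans (lt_add_one _).le)]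
  exact cl_mono (fun x => (le_max_right _ _).trans (gseq_le (lt_add_one _))) sg_cl


end

section
open Order Filter

open Classical in
noncomputable def bf {ι : Type} (E : Ordinal.{0} → Set Ordinal.{0}) (m : ι → Cardinal.{0})
    (ξ : Ordinal.{0}) (i : ι) : Ordinal.{0} :=
  if ξ.cof ≤ m i then ls (range fun α : ↥(E ξ ∩ Iio ξ) => bf E m α i) else 0
termination_by ξ
decreasing_by exact α.2.2

lemma bf_eq {ι : Type} {E : Ordinal.{0} → Set Ordinal.{0}} {m : ι → Cardinal.{0}}
    {ξ : Ordinal.{0}} {i : ι} (h : ξ.cof ≤ m i) :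
    bf E m ξ i = ls (range fun α : ↥(E ξ ∩ Iio ξ) => bf E m α i) := by
  rw [bf, if_pos h]

lemma bf_lt_bf {ι : Type} {E : Ordinal.{0} → Set Ordinal.{0}} {m : ι → Cardinal.{0}}
    {ξ : Ordinal.{0}} {i : ι} (h : ξ.cof ≤ m i) {α} (hα : α ∈ E ξ) (hlt : α < ξ) :
    bf E m α i < bf E m ξ i := by
  rw [bf_eq h]
  have : Small.{0} ↥(E ξ ∩ Iio ξ) := small_subset inter_subset_right
  exact lt_ls ⟨⟨α, hα, hlt⟩, rfl⟩

lemma bf_lt {ι : Type} {E : Ordinal.{0} → Set Ordinal.{0}} {m : ι → Cardinal.{0}}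
    (hE : ∀ ξ, #(E ξ) ≤ lift.{1,0} (ξ.cof + ξ.cof))
    {i : ι} (hm : ℵ₀ ≤ m i) (ξ : Ordinal.{0}) : bf E m ξ i < (succ (m i)).ord := by
  induction ξ using WellFoundedLT.induction with
  | ind ξ ih =>
    have hr := isRegular_succ hm
    by_cases h : ξ.cof ≤ m i
    · rw [bf_eq h]
      refine ls_lt hr ?_ ?_
      · refine lt_of_le_of_lt (mk_range_le.trans ((mk_le_mk_of_subset inter_subset_left).trans (hE ξ))) ?_
        rw [Cardinal.lift_lt]
        refine lt_of_le_of_lt (add_le_add h h) ?_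
        rw [add_eq_self hm]; exact lt_succ _
      · rintro _ ⟨α, rfl⟩; exact ih α α.2.2
    · rw [bf, if_neg h]; exact hr.ord_pos

lemma cof_lt_sing {μ : Cardinal.{0}} (hμ : ℵ₀ ≤ μ) (hs : μ.ord.cof < μ) {ξ : Ordinal.{0}}
    (hξ : ξ < (succ μ).ord) : ξ.cof < μ := by
  have h1 : ξ.cof ≤ μ := (Ordinal.cof_le_card ξ).trans (lt_succ_iff.mp (lt_ord.mp hξ))
  refine lt_of_le_of_ne h1 fun h => ?_
  have := Ordinal.cof_ord_cof ξ
  rw [h] at this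
  exact hs.ne this

/-- continuous history recursion -/
noncomputable def xiS (stp : Ordinal.{0} → (Ordinal.{0} → Ordinal.{0}) → Ordinal.{0})
    (j : Ordinal.{0}) : Ordinal.{0} :=
  sSup (range fun i : Iio j => stp i
    (fun l => open Classical in if h : l ≤ i then xiS stp l else 0))
termination_by j
decreasing_by exact lt_of_le_of_lt h i.2

noncomputable def trn (x : Ordinal.{0} → Ordinal.{0}) (j : Ordinal.{0}) (l : Ordinal.{0}) : Ordinal.{0} :=
  open Classical in if l ≤ j then x l else 0
lemma trn_eq {x j l} (h : l ≤ j) : trn x j l = x l := if_pos h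

lemma xiS_eq (stp : Ordinal.{0} → (Ordinal.{0} → Ordinal.{0}) → Ordinal.{0}) (j : Ordinal.{0}) :
    xiS stp j = sSup (range fun i : Iio j => stp i (trn (xiS stp) i)) := by
  rw [xiS]; rfl

lemma xiS_step {stp : Ordinal.{0} → (Ordinal.{0} → Ordinal.{0}) → Ordinal.{0}} {i j} (h : i < j) :
    stp i (trn (xiS stp) i) ≤ xiS stp j := by
  rw [xiS_eq stp j]
  exact le_csSup Ordinal.bddAbove_of_small ⟨⟨i, h⟩, rfl⟩

lemma lt_xiS {stp : Ordinal.{0} → (Ordinal.{0} → Ordinal.{0}) → Ordinal.{0}} {y j} (h : y < xiS stp j) :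
    ∃ i < j, y < stp i (trn (xiS stp) i) := by
  by_contra hc; push Not at hc
  refine absurd h (not_lt.mpr ?_)
  rw [xiS_eq]; refine csSup_le' ?_
  rintro _ ⟨i, rfl⟩; exact hc i i.2

lemma xiS_lt {stp : Ordinal.{0} → (Ordinal.{0} → Ordinal.{0}) → Ordinal.{0}} {c : Cardinal.{0}}
    (hc : c.IsRegular)
    (hs : ∀ j x, (∀ l ≤ j, x l < c.ord) → stp j x < c.ord) {j} (hj : j < c.ord) : xiS stp j < c.ord := by
  induction j using WellFoundedLT.induction with
  | ind j ih =>
    have : ls ((fun i => stp i (trn (xiS stp) i)) '' Iio j) < c.ord :=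
      lsI_lt hc hj fun i hi => hs _ _ fun l hl => by
        rw [trn_eq hl]; exact ih l (hl.trans_lt hi) ((hl.trans_lt hi).trans hj)
    refine lt_of_le_of_lt ?_ this
    rw [xiS_eq]; refine csSup_le' ?_
    rintro _ ⟨i, rfl⟩
    exact (lt_ls (X := (fun i => stp i (trn (xiS stp) i)) '' Iio j) ⟨i, i.2, rfl⟩).le

theorem BP {ι : Type} [LinearOrder ι] [Nonempty ι] [NoMaxOrder ι] {μ : Cardinal.{0}}
    (m : ι → Cardinal.{0}) (hμ : ℵ₀ ≤ μ) (hs : μ.ord.cof < μ) (hlim : ∀ k < μ, succ k < μ)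
    (hm : ∀ i, ℵ₀ ≤ m i) (hm2 : ∀ k < μ, ∀ᶠ i in atTop, k ≤ m i) (hι : #ι < μ) :
    ∃ f : Ordinal.{0} → ι → Ordinal.{0}, (∀ ξ i, f ξ i < (succ (m i)).ord) ∧
      (∀ α ξ, α < ξ → ξ < (succ μ).ord → ∀ᶠ i in atTop, f α i < f ξ i) ∧
      ∀ κ < μ, ∀ S : ι → Set Ordinal.{0}, (∀ i, #(S i) ≤ lift.{1,0} κ) →
        ∃ ξ < (succ μ).ord, ∀ ξ', ξ < ξ' → ξ' < (succ μ).ord →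
          ∀ᶠ i in atTop, ∀ s ∈ S i, ¬ (f ξ i ≤ s ∧ s < f ξ' i) := by
  have hΛ : (succ μ).IsRegular := isRegular_succ hμ
  choose e he1 he2 he3 using exists_cof_seq
  let E : Ordinal.{0} → Set Ordinal.{0} := fun ξ =>
    (fun j => ls (e ξ '' Iio j)) '' Iio ξ.cof.ord ∪ e ξ '' Iio ξ.cof.ord
  have hEsub : ∀ ξ, ∀ α ∈ E ξ, α < ξ := by
    rintro ξ α (⟨j, hj, rfl⟩ | ⟨j, hj, rfl⟩)
    · refine lt_of_le_of_lt (ls_le ?_) (he1 ξ j hj)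
      rintro _ ⟨i, hi, rfl⟩; exact he2 ξ j hj i hi
    · exact he1 ξ j hj
  have hEcard : ∀ ξ, #(E ξ) ≤ lift.{1,0} (ξ.cof + ξ.cof) := by
    intro ξ
    refine (mk_union_le _ _).trans ?_
    rw [Cardinal.lift_add]
    have h1 : #(Iio ξ.cof.ord) = lift.{1,0} ξ.cof := by rw [mk_Iio_ordinal, card_ord]
    exact add_le_add (mk_image_le.trans h1.le) (mk_image_le.trans h1.le)
  set f := bf E m with hf
  have hinc : ∀ ξ, ξ < (succ μ).ord → ∀ α, α < ξ → ∀ᶠ i in atTop, f α i < f ξ i := by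
    intro ξ
    induction ξ using WellFoundedLT.induction with
    | ind ξ ih =>
      intro hξ α hα
      obtain ⟨j, hj, hle⟩ := he3 ξ α hα
      have hE : e ξ j ∈ E ξ := Or.inr ⟨j, hj, rfl⟩
      have h1 : ∀ᶠ i in atTop, f (e ξ j) i < f ξ i := by
        filter_upwards [hm2 _ (cof_lt_sing hμ hs hξ)] with i hi
        exact bf_lt_bf hi hE (he1 ξ j hj)
      rcases hle.eq_or_lt with h | h
      · rwa [h]
      · filter_upwards [h1, ih _ (he1 ξ j hj) ((he1 ξ j hj).trans hξ) α h] with i h2 h3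
        exact h3.trans h2
  refine ⟨f, fun ξ i => bf_lt hEcard (hm i) ξ, fun α ξ h1 h2 => hinc ξ h2 α h1, ?_⟩
  intro κ hκ S hS
  by_contra hcon
  push Not at hcon
  choose! cr hcr1 hcr2 hcr3 using hcon
  set ν : Cardinal.{0} := succ (max (max κ #ι) ℵ₀) with hν
  have hℵμ : ℵ₀ < μ := by
    refine lt_of_le_of_ne hμ ?_
    rintro rfl
    simp at hs
  have hνμ : ν < μ := hlim _ (max_lt (max_lt hκ hι) hℵμ)
  have hνr : ν.IsRegular := isRegular_succ (le_max_right _ _)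
  have hκν : κ < ν := lt_succ_of_le ((le_max_left _ _).trans (le_max_left _ _))
  have hιν : #ι < ν := lt_succ_of_le ((le_max_right _ _).trans (le_max_left _ _))
  obtain ⟨τ, hτ⟩ : ∃ τ, τ = succ (succ ν) := ⟨_, rfl⟩
  have hτμ : τ < μ := hτ ▸ hlim _ (hlim _ hνμ)
  have hτr : τ.IsRegular := by
    rw [hτ]; exact isRegular_succ (hνr.aleph0_le.trans (le_succ _))
  obtain ⟨C, hC⟩ := club_guess hνr hτ
  have hτΛ : τ.ord < (succ μ).ord := ord_lt_ord.mpr (hτμ.trans (lt_succ μ))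
  let h : Ordinal.{0} → Ordinal.{0} → (Ordinal.{0} → Ordinal.{0}) → ι → Ordinal.{0} :=
    fun α j x i => sSup ((fun l => f (x l) i) '' (C α ∩ Iic j))
  have hle' : ∀ α ξ, α ≤ ξ → ξ < (succ μ).ord → ∀ᶠ i in atTop, f α i ≤ f ξ i := by
    intro α ξ h1 h2
    rcases h1.eq_or_lt with rfl | h1
    · simp
    · filter_upwards [hinc ξ h2 α h1] with i hi using hi.le
  have hstp : ∀ (j : Ordinal.{0}) (x : Ordinal.{0} → Ordinal.{0}), ∃ σ : Ordinal.{0},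
      (∀ l ≤ j, x l < (succ μ).ord) → σ < (succ μ).ord ∧ x j < σ ∧ cr (x j) ≤ σ ∧
        ∀ α < τ.ord, (∃ ρ < (succ μ).ord, ∀ᶠ i in atTop, h α j x i ≤ f ρ i) →
          ∀ᶠ i in atTop, h α j x i ≤ f σ i := by
    intro j x
    by_cases hx : ∀ l ≤ j, x l < (succ μ).ord
    swap
    · exact ⟨0, fun h => absurd h hx⟩
    have : ∀ α, ∃ ρ < (succ μ).ord, (∃ ρ < (succ μ).ord, ∀ᶠ i in atTop, h α j x i ≤ f ρ i) → 
        ∀ᶠ i in atTop, h α j x i ≤ f ρ i := by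
      intro α
      by_cases hp : ∃ ρ < (succ μ).ord, ∀ᶠ i in atTop, h α j x i ≤ f ρ i
      · obtain ⟨ρ, h1, h2⟩ := hp; exact ⟨ρ, h1, fun _ => h2⟩
      · exact ⟨0, hΛ.ord_pos, fun h => absurd h hp⟩
    choose ρ hρ1 hρ2 using this
    have hb : ls (ρ '' Iio τ.ord) < (succ μ).ord := lsI_lt hΛ hτΛ fun α _ => hρ1 α
    have hxj := hx j le_rfl
    refine ⟨max (x j + 1) (max (cr (x j)) (ls (ρ '' Iio τ.ord))), fun _ => ⟨?_, ?_, ?_, ?_⟩⟩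
    · exact max_lt (succ_lt_reg hΛ.aleph0_le hxj) (max_lt (hcr2 _ hxj) hb)
    · exact (lt_add_one _).trans_le (le_max_left _ _)
    · exact (le_max_left _ _).trans (le_max_right _ _)
    · intro α hα hp
      have h1 : ρ α ≤ max (x j + 1) (max (cr (x j)) (ls (ρ '' Iio τ.ord))) :=
        ((lt_ls (X := ρ '' Iio τ.ord) ⟨α, hα, rfl⟩).le.trans (le_max_right _ _)).trans (le_max_right _ _)
      filter_upwards [hρ2 α hp, hle' _ _ h1
        (max_lt (succ_lt_reg hΛ.aleph0_le hxj) (max_lt (hcr2 _ hxj) hb))] with i h2 h3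
      exact h2.trans h3
  choose stp hstp using hstp
  set xi := xiS stp with hxi
  have hxlt : ∀ j ≤ τ.ord, xi j < (succ μ).ord := fun j hj =>
    xiS_lt hΛ (fun j x hx => (hstp j x hx).1) (hj.trans_lt hτΛ)
  have htr : ∀ j < τ.ord, ∀ l ≤ j, trn xi j l < (succ μ).ord := by
    intro j hj l hl; rw [trn_eq hl]; exact hxlt l (hl.trans hj.le)
  have hxmono : ∀ j ≤ τ.ord, ∀ i < j, xi i < xi j := by
    intro j hj i hi
    have := (hstp i (trn xi i) (htr i (hi.trans_le hj))).2.1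
    rw [trn_eq le_rfl] at this
    exact this.trans_le (xiS_step hi)
  have hxmono' : ∀ j ≤ τ.ord, ∀ i ≤ j, xi i ≤ xi j := by
    intro j hj i hi
    rcases hi.eq_or_lt with rfl | hi
    · rfl
    · exact (hxmono j hj i hi).le
  have hxcr : ∀ j ≤ τ.ord, ∀ i < j, cr (xi i) ≤ xi j := by
    intro j hj i hi
    have := (hstp i (trn xi i) (htr i (hi.trans_le hj))).2.2.1
    rw [trn_eq le_rfl] at this
    exact this.trans (xiS_step hi)
  have hheq : ∀ α j, h α j (trn xi j) = h α j xi := by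
    intro α j; funext i
    show sSup _ = sSup _
    congr 1
    refine image_congr fun l hl => ?_
    rw [trn_eq hl.2]
  have hτlim := isSuccLimit_ord hτr.aleph0_le
  have hcont : ∀ j, (∀ i < j, i + 1 < j) → ∀ y < xi j, ∃ i < j, y < xi i := by
    intro j hj y hy
    obtain ⟨i, hi, h1⟩ := lt_xiS hy
    exact ⟨i + 1, hj i hi, h1.trans_le (xiS_step (lt_add_one i))⟩
  set δ := xi τ.ord with hδ
  have hδΛ : δ < (succ μ).ord := hxlt _ le_rfl
  have hδcof : δ.cof = τ := by
    rw [cof_eq_of_seq (a := τ.ord) xi, hτr.cof_ord]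
    · exact fun j hj => hxmono _ le_rfl j hj
    · exact fun j hj i hi => hxmono j hj.le i hi
    · intro x hx
      obtain ⟨i, hi, h1⟩ := hcont τ.ord (fun i hi => hτlim.add_one_lt hi) x hx
      exact ⟨i, hi, h1.le⟩
  have hk1 : ∀ j, ∃ k < τ.ord, j < τ.ord → e δ j ≤ xi k := by
    intro j
    by_cases hj : j < τ.ord
    · obtain ⟨k, hk, h1⟩ := hcont τ.ord (fun i hi => hτlim.add_one_lt hi) (e δ j)
        (he1 δ j (by rwa [hδcof]))
      exact ⟨k, hk, fun _ => h1.le⟩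
    · exact ⟨0, hτr.ord_pos, fun h => absurd h hj⟩
  have hk2 : ∀ j, ∃ k < τ.ord, j < τ.ord → xi j ≤ e δ k := by
    intro j
    by_cases hj : j < τ.ord
    · obtain ⟨k, hk, h1⟩ := he3 δ (xi j) (hxmono _ le_rfl _ hj)
      rw [hδcof] at hk
      exact ⟨k, hk, fun _ => h1⟩
    · exact ⟨0, hτr.ord_pos, fun h => absurd h hj⟩
  choose k1 hk11 hk12 using hk1
  choose k2 hk21 hk22 using hk2
  obtain ⟨α, hα, hαcof, hCα, hCcof⟩ := hC (fun j => max (j + 1) (max (k1 j) (k2 j)))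
    (fun x hx => max_lt (hτlim.add_one_lt hx) (max_lt (hk11 x) (hk21 x)))
  have hCτ : ∀ j ∈ C α, j < τ.ord := fun j hj => (hCα j hj).1.trans hα
  have hClim : ∀ j ∈ C α, ∀ i < j, i + 1 < j := fun j hj i hi =>
    (le_max_left _ _).trans_lt ((hCα j hj).2.2 i hi)
  have hxE : ∀ j ∈ C α, xi j ∈ E δ := by
    intro j hj
    left
    refine ⟨j, by rw [hδcof]; exact hCτ j hj, ?_⟩
    apply le_antisymm
    · refine ls_le ?_
      rintro _ ⟨i, hi, rfl⟩
      have hk : k1 i < j := lt_of_le_of_lt ((le_max_left _ _).trans (le_max_right _ _))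
        ((hCα j hj).2.2 i hi)
      exact (hk12 i (hi.trans (hCτ j hj))).trans_lt (hxmono j (hCτ j hj).le _ hk)
    · by_contra hc; push Not at hc
      obtain ⟨i, hi, h1⟩ := hcont j (hClim j hj) _ hc
      have hk : k2 i < j := lt_of_le_of_lt ((le_max_right _ _).trans (le_max_right _ _))
        ((hCα j hj).2.2 i hi)
      have h2 := h1.trans_le (hk22 i (hi.trans (hCτ j hj)))
      exact absurd (lt_ls (X := e δ '' Iio j) ⟨k2 i, hk, rfl⟩) (not_lt.mpr h2.le)
  have hhle : ∀ j ∈ C α, ∀ᶠ i in atTop, h α j xi i ≤ f (xi (j + 1)) i := by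
    intro j hj
    have h1 : ∀ᶠ i in atTop, h α j xi i ≤ f δ i := by
      filter_upwards [hm2 _ hτμ] with i hi
      refine csSup_le' ?_
      rintro _ ⟨l, ⟨hl, hl'⟩, rfl⟩
      exact (bf_lt_bf (by rwa [hδcof]) (hxE l hl) (hEsub _ _ (hxE l hl))).le
    have h2 := (hstp j (trn xi j) (htr j (hCτ j hj))).2.2.2 α hα ⟨δ, hδΛ, by rwa [hheq]⟩
    rw [hheq] at h2
    filter_upwards [h2, hle' _ _ (xiS_step (stp := stp) (lt_add_one j))
      (hxlt _ (hτlim.add_one_lt (hCτ j hj)).le)] with i h3 h4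
    exact h3.trans h4
  have hnx : ∀ j, ∃ n, j ∈ C α → n ∈ C α ∧ j < n ∧ ∀ j' ∈ C α, j < j' → n ≤ j' := by
    intro j
    by_cases hj : j ∈ C α
    · obtain ⟨y, hy, hy'⟩ := hCcof j (hCα j hj).1
      obtain ⟨n, hn, hmin⟩ := exists_minimal_of_wellFoundedLT (fun n => n ∈ C α ∧ j < n) ⟨y, hy, hy'⟩
      refine ⟨n, fun _ => ⟨hn.1, hn.2, fun j' h1 h2 => ?_⟩⟩
      by_contra hc; push Not at hc
      exact absurd (hmin ⟨h1, h2⟩ hc.le) (not_le.mpr hc)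
    · exact ⟨0, fun h => absurd h hj⟩
  choose nx hnx using hnx
  have hpick : ∀ j, ∃ (i : ι) (s : Ordinal.{0}), j ∈ C α → s ∈ S i ∧ h α j xi i ≤ s ∧ s < f (xi (nx j)) i := by
    intro j
    by_cases hj : j ∈ C α
    · obtain ⟨h1, h2, h3⟩ := hnx j hj
      have hj1 : j + 1 < nx j := hClim _ h1 j h2
      have hj1τ := (hτlim.add_one_lt (hCτ j hj))
      have hfr := hcr3 (xi (j+1)) (hxlt _ hj1τ.le)
      have hev := hle' _ _ (hxcr (nx j) (hCτ _ h1).le _ hj1) (hxlt _ (hCτ _ h1).le)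
      obtain ⟨i, ⟨s, hs1, hs2, hs3⟩, h4, h5⟩ := (hfr.and_eventually (hev.and (hhle j hj))).exists
      exact ⟨i, s, fun _ => ⟨hs1, h5.trans hs2, hs3.trans_le h4⟩⟩
    · exact ⟨Classical.arbitrary ι, 0, fun h => absurd h hj⟩
  choose ii ss hiss using hpick
  have hssm : ∀ j ∈ C α, ∀ j' ∈ C α, j < j' → ii j = ii j' → ss j < ss j' := by
    intro j hj j' hj' hlt heq
    obtain ⟨h1, h2, h3⟩ := hnx j hj
    refine (hiss j hj).2.2.trans_le (le_trans ?_ (hiss j' hj').2.1)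
    rw [heq]
    have : Small.{0} ↥(C α ∩ Iic j') := small_subset inter_subset_right
    exact le_csSup Ordinal.bddAbove_of_small ⟨nx j, ⟨h1, h3 j' hj' hlt⟩, rfl⟩
  have hT : ∀ i, #{j | j ∈ C α ∧ ii j = i} < lift.{1,0} ν := by
    intro i
    refine lt_of_le_of_lt ?_ (Cardinal.lift_lt.mpr hκν)
    refine le_trans ?_ (hS i)
    refine mk_le_of_injective (f := fun j : {j | j ∈ C α ∧ ii j = i} =>
      (⟨ss j, by have h0 := (hiss j j.2.1).1; rwa [j.2.2] at h0⟩ : S i)) ?_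
    rintro ⟨j, hj, rfl⟩ ⟨j', hj', hij'⟩ heq
    simp only [Subtype.mk.injEq] at heq ⊢
    rcases lt_trichotomy j j' with h1 | h1 | h1
    · exact absurd heq (hssm j hj j' hj' h1 hij'.symm).ne
    · exact h1
    · exact absurd heq (hssm j' hj' j hj h1 hij').ne'
  have hTb : ∀ i, ls {j | j ∈ C α ∧ ii j = i} < α := fun i =>
    ls_lt_cof (by rw [hαcof]; exact hT i) fun x hx => (hCα x hx.1).1
  have hb : ls (range fun i => ls {j | j ∈ C α ∧ ii j = i}) < α :=
    ls_lt_cof (by rw [hαcof]; exact mk_range_lt _ hιν) (by rintro _ ⟨i, rfl⟩; exact hTb i)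
  obtain ⟨y, hy, hlt⟩ := hCcof _ hb
  have := small_of_lt (hT (ii y)).le
  have h1 : y < ls {j | j ∈ C α ∧ ii j = ii y} := lt_ls ⟨hy, rfl⟩
  have h2 : ls {j | j ∈ C α ∧ ii j = ii y} < ls (range fun i => ls {j | j ∈ C α ∧ ii j = i}) :=
    lt_ls ⟨ii y, rfl⟩
  exact lt_irrefl _ (h1.trans (h2.trans hlt))


end

section
open Order Filter

noncomputable def gE (F : (ℕ → Set Ordinal.{0}) → ℕ → Ordinal.{0}) (M : ℕ → Ordinal.{0})
    (α : Ordinal.{0}) : ℕ → Ordinal.{0} :=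
  F (fun n => insert (M n) (range fun β : Iio α => gE F M β n))
termination_by α
decreasing_by exact β.2

lemma exists_eub {μ : Cardinal.{0}} {m : ℕ → Cardinal.{0}} {f : Ordinal.{0} → ℕ → Ordinal.{0}}
    (hμ : ℵ₀ < μ)
    (hf1 : ∀ ξ n, f ξ n < (succ (m n)).ord)
    (hf2 : ∀ α ξ, α < ξ → ξ < (succ μ).ord → ∀ᶠ i in atTop, f α i < f ξ i)
    (hf3 : ∀ κ < μ, ∀ S : ℕ → Set Ordinal.{0}, (∀ i, #(S i) ≤ lift.{1,0} κ) →
        ∃ ξ < (succ μ).ord, ∀ ξ', ξ < ξ' → ξ' < (succ μ).ord →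
          ∀ᶠ i in atTop, ∀ s ∈ S i, ¬ (f ξ i ≤ s ∧ s < f ξ' i)) :
    ∃ h : ℕ → Ordinal.{0}, (∀ n, h n ≤ (succ (m n)).ord) ∧
      (∀ ξ < (succ μ).ord, ∀ᶠ n in atTop, f ξ n < h n) ∧
      ∀ g : ℕ → Ordinal.{0}, (∀ᶠ n in atTop, g n < h n) →
        ∃ ξ < (succ μ).ord, ∀ᶠ n in atTop, g n < f ξ n := by
  have hΛ : (succ μ).IsRegular := isRegular_succ hμ.le
  have hΛl := isSuccLimit_ord hΛ.aleph0_le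
  by_contra hcon
  push Not at hcon
  choose! nxt hn1 hn2 using hcon
  have hξS : ∀ S : ℕ → Set Ordinal.{0}, ∃ ξ, (∀ i, #(S i) ≤ lift.{1,0} ℵ₀) → ξ < (succ μ).ord ∧
      ∀ ξ', ξ < ξ' → ξ' < (succ μ).ord →
          ∀ᶠ i in atTop, ∀ s ∈ S i, ¬ (f ξ i ≤ s ∧ s < f ξ' i) := by
    intro S
    by_cases hS : ∀ i, #(S i) ≤ lift.{1,0} ℵ₀
    · obtain ⟨ξ, h1, h2⟩ := hf3 ℵ₀ hμ S hS
      exact ⟨ξ, fun _ => ⟨h1, h2⟩⟩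
    · exact ⟨0, fun h => absurd h hS⟩
  choose ξS hξS using hξS
  let hh : (ℕ → Set Ordinal.{0}) → Ordinal.{0} → ℕ → Ordinal.{0} :=
    fun S ξ n => sInf {s | s ∈ S n ∧ f ξ n ≤ s}
  let M : ℕ → Ordinal.{0} := fun n => (succ (m n)).ord
  let F : (ℕ → Set Ordinal.{0}) → ℕ → Ordinal.{0} := fun S => nxt (hh S (ξS S))
  let g := gE F M
  let SS : Ordinal.{0} → ℕ → Set Ordinal.{0} := fun α n => insert (M n) (range fun β : Iio α => g β n)
  have hg : ∀ α, g α = nxt (hh (SS α) (ξS (SS α))) := by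
    intro α
    show gE F M α = _
    rw [gE]
  have hScard : ∀ α < (ℵ_ 1).ord, ∀ n, #(SS α n) ≤ lift.{1,0} ℵ₀ := by
    intro α hα n
    have h1 : #(Iio α) ≤ ℵ₀ := by
      have := mk_Iio_lt hα
      rw [← succ_aleph0, lift_succ, lift_aleph0] at this
      exact lt_succ_iff.mp this
    have : (SS α n).Countable := by
      refine Countable.insert _ ?_
      have : Countable (Iio α) := mk_le_aleph0_iff.mp h1
      exact countable_range _
    rw [lift_aleph0]
    exact this.le_aleph0
  have hmem : ∀ α ξ n, hh (SS α) ξ n ∈ SS α n ∧ f ξ n ≤ hh (SS α) ξ n := by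
    intro α ξ n
    exact csInf_mem (s := {s | s ∈ SS α n ∧ f ξ n ≤ s}) ⟨M n, mem_insert _ _, (hf1 ξ n).le⟩
  have hhle : ∀ α ξ n s, s ∈ SS α n → f ξ n ≤ s → hh (SS α) ξ n ≤ s := by
    intro α ξ n s h1 h2
    exact csInf_le' (s := {s | s ∈ SS α n ∧ f ξ n ≤ s}) ⟨h1, h2⟩
  have hhM : ∀ α ξ n, hh (SS α) ξ n ≤ M n := fun α ξ n =>
    hhle _ _ _ _ (mem_insert _ _) (hf1 ξ n).le
  have hbd : ∀ α < (ℵ_ 1).ord, ∀ ξ < (succ μ).ord,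
      ∀ᶠ n in atTop, f ξ n < hh (SS α) (ξS (SS α)) n := by
    intro α hα ξ hξ
    obtain ⟨h1, h2⟩ := hξS (SS α) (hScard α hα)
    have h3 : max ξ (ξS (SS α)) + 1 < (succ μ).ord := hΛl.add_one_lt (max_lt hξ h1)
    have h4 : ξ < max ξ (ξS (SS α)) + 1 := lt_of_le_of_lt (le_max_left _ _) (lt_add_one _)
    have h5 : ξS (SS α) < max ξ (ξS (SS α)) + 1 := lt_of_le_of_lt (le_max_right _ _) (lt_add_one _)
    filter_upwards [h2 _ h5 h3, hf2 _ _ h4 h3] with n h6 h7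
    have := h6 _ (hmem α (ξS (SS α)) n).1
    push Not at this
    exact h7.trans_le (this (hmem α (ξS (SS α)) n).2)
  set ξs := ls ((fun α => ξS (SS α)) '' Iio (ℵ_ 1).ord) with hξs
  have hℵ1 : ℵ_ 1 < succ μ := by
    rw [← succ_aleph0]; exact lt_succ_of_le (succ_le_of_lt hμ)
  have hξsΛ : ξs < (succ μ).ord := lsI_lt hΛ (ord_lt_ord.mpr hℵ1) fun α hα => (hξS _ (hScard α hα)).1
  have heq : ∀ α < (ℵ_ 1).ord, ∀ᶠ n in atTop, hh (SS α) (ξS (SS α)) n = hh (SS α) ξs n := by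
    intro α hα
    obtain ⟨h1, h2⟩ := hξS (SS α) (hScard α hα)
    have h3 : ξS (SS α) < ξs := lt_ls ⟨α, hα, rfl⟩
    filter_upwards [h2 _ h3 hξsΛ, hf2 _ _ h3 hξsΛ] with n h4 h5
    apply le_antisymm
    · exact hhle _ _ _ _ (hmem _ _ _).1 (h5.le.trans (hmem _ _ _).2)
    · refine hhle _ _ _ _ (hmem _ _ _).1 ?_
      have := h4 _ (hmem α (ξS (SS α)) n).1
      push Not at this
      exact this (hmem α (ξS (SS α)) n).2
  have hanti : ∀ n α β, α ≤ β → hh (SS β) ξs n ≤ hh (SS α) ξs n := by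
    intro n α β hαβ
    refine hhle _ _ _ _ ?_ (hmem _ _ _).2
    rcases (hmem α ξs n).1 with h | ⟨⟨γ, hγ⟩, h⟩
    · exact Or.inl h
    · exact Or.inr ⟨⟨γ, lt_of_lt_of_le hγ hαβ⟩, h⟩
  have hℵr : (ℵ_ 1).IsRegular := isRegular_aleph_one
  have hstab : ∀ n, ∃ ε < (ℵ_ 1).ord, ∀ ε' < (ℵ_ 1).ord, ε ≤ ε' →
      hh (SS ε') ξs n = hh (SS ε) ξs n := by
    intro n
    obtain ⟨ε, hε, hmin⟩ := exists_minimalFor_of_wellFoundedLT (fun ε => ε < (ℵ_ 1).ord)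
      (fun ε => hh (SS ε) ξs n) ⟨0, hℵr.ord_pos⟩
    exact ⟨ε, hε, fun ε' hε' hle => le_antisymm (hanti n _ _ hle) (hmin hε' (hanti n _ _ hle))⟩
  choose ε hε1 hε2 using hstab
  have hεs : ls (range ε) < (ℵ_ 1).ord := lsr_lt hℵr (by
    rw [mk_nat, ← aleph_zero]; exact aleph_lt_aleph.mpr zero_lt_one) hε1
  set εs := ls (range ε) with hεs'
  have hεs1 : εs + 1 < (ℵ_ 1).ord := succ_lt_reg hℵr.aleph0_le hεs
  have hlt := hn1 (hh (SS εs) (ξS (SS εs))) (hhM _ _) (hbd _ hεs)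
  have hfr := hn2 (hh (SS εs) (ξS (SS εs))) (hhM _ _) (hbd _ hεs) ξs hξsΛ
  rw [← hg] at hlt hfr
  obtain ⟨n, h1, h2, h3⟩ := (hfr.and_eventually (hlt.and (heq _ hεs))).exists
  have h4 : hh (SS (εs + 1)) ξs n ≤ g εs n :=
    hhle _ _ _ _ (Or.inr ⟨⟨εs, lt_add_one εs⟩, rfl⟩) h1
  have h5 : ε n < εs := lt_ls ⟨n, rfl⟩
  have h6 : hh (SS (εs + 1)) ξs n = hh (SS εs) ξs n := by
    rw [hε2 n _ hεs h5.le, hε2 n _ hεs1 (h5.le.trans (lt_add_one _).le)]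
  rw [h6, ← h3] at h4
  exact absurd h2 (not_lt.mpr h4)

lemma exists_m {μ : Cardinal.{0}} (hμ : ℵ₀ < μ) (hcof : μ.ord.cof = ℵ₀) :
    ∃ m : ℕ → Cardinal.{0}, (∀ n, ℵ₀ ≤ m n) ∧ (∀ n, m n < μ) ∧
      ∀ k < μ, ∀ᶠ n in atTop, k ≤ m n := by
  obtain ⟨e, he1, he2, he3⟩ := exists_cof_seq μ.ord
  rw [hcof, ord_aleph0] at *
  refine ⟨fun n => max ℵ₀ (e n).card, fun n => le_max_left _ _, fun n => max_lt hμ ?_, ?_⟩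
  · exact lt_ord.mp (he1 n (Ordinal.natCast_lt_omega0 n))
  · intro k hk
    obtain ⟨j, hj, h⟩ := he3 k.ord (ord_lt_ord.mpr hk)
    obtain ⟨n, rfl⟩ := Ordinal.lt_omega0.mp hj
    filter_upwards [eventually_ge_atTop n] with n' hn'
    refine le_max_of_le_right ?_
    rw [← ord_le]
    refine h.trans ?_
    rcases hn'.eq_or_lt with rfl | h'
    · rfl
    · exact (he2 n' (Ordinal.natCast_lt_omega0 n') n (by exact_mod_cast h')).le

theorem exists_scale {μ : Cardinal.{0}} (hμ : ℵ₀ < μ) (hcof : μ.ord.cof = ℵ₀)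
    (hlim : ∀ k < μ, succ k < μ) :
    ∃ (lam : ℕ → Cardinal.{0}) (f : Ordinal.{0} → ℕ → Ordinal.{0}),
      (∀ k, (lam k).IsRegular) ∧ StrictMono lam ∧ (∀ k, ℵ_ 1 < lam k) ∧ (∀ k, lam k < μ) ∧
      (∀ c < μ, ∃ k, c < lam k) ∧ (∀ ξ k, f ξ k < (lam k).ord) ∧
      (∀ ξ ξ', ξ ≤ ξ' → ξ' < (succ μ).ord → ∀ᶠ k in atTop, f ξ k ≤ f ξ' k) ∧
      (∀ g : ℕ → Ordinal.{0}, (∀ k, g k < (lam k).ord) →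
        ∃ σ < (succ μ).ord, ∀ᶠ k in atTop, g k < f σ k) := by
  obtain ⟨m, hm1, hm2, hm3⟩ := exists_m hμ hcof
  have hΛ : (succ μ).IsRegular := isRegular_succ hμ.le
  have hΛl := isSuccLimit_ord hΛ.aleph0_le
  obtain ⟨f, hf1, hf2, hf3⟩ := BP m hμ.le (by rwa [hcof]) hlim hm1 hm3 (by rwa [mk_nat])
  obtain ⟨h, hh1, hh2, hh3⟩ := exists_eub hμ hf1 hf2 hf3
  choose e he1 he2 he3 using exists_cof_seq
  have hle : ∀ α ξ, α ≤ ξ → ξ < (succ μ).ord → ∀ᶠ i in atTop, f α i ≤ f ξ i := by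
    intro α ξ h1 h2
    rcases h1.eq_or_lt with rfl | h1
    · simp
    · filter_upwards [hf2 α ξ h1 h2] with i hi using hi.le
  have hcofh : ∀ κ < μ, ∀ᶠ n in atTop, κ < (h n).cof := by
    intro κ hκ
    by_contra hcon
    rw [not_eventually] at hcon
    simp only [not_lt] at hcon
    classical
    let S : ℕ → Set Ordinal.{0} := fun n =>
      if (h n).cof ≤ κ then e (h n) '' Iio (h n).cof.ord else ∅
    have hS : ∀ n, #(S n) ≤ lift.{1,0} κ := by
      intro n
      by_cases hn : (h n).cof ≤ κ
      · simp only [S, hn, if_true]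
        refine mk_image_le.trans ?_
        rw [mk_Iio_ordinal, card_ord, Cardinal.lift_le]; exact hn
      · simp [S, hn]
    obtain ⟨ξ, hξ, hξ'⟩ := hf3 κ hκ S hS
    have hgex : ∀ n, ∃ s, f ξ n < h n → s < h n ∧ f ξ n ≤ s ∧ ((h n).cof ≤ κ → s ∈ S n) := by
      intro n
      by_cases h1 : f ξ n < h n
      · by_cases h2 : (h n).cof ≤ κ
        · obtain ⟨j, hj, hj'⟩ := he3 (h n) _ h1
          refine ⟨e (h n) j, fun _ => ⟨he1 _ _ hj, hj', fun _ => ?_⟩⟩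
          simp only [S, h2, if_true]; exact ⟨j, hj, rfl⟩
        · exact ⟨f ξ n, fun _ => ⟨h1, le_rfl, fun h => absurd h h2⟩⟩
      · exact ⟨0, fun h => absurd h h1⟩
    choose g hg using hgex
    obtain ⟨σ, hσ, hσ'⟩ := hh3 g (by filter_upwards [hh2 ξ hξ] with n hn using (hg n hn).1)
    have h3 : max ξ σ + 1 < (succ μ).ord := hΛl.add_one_lt (max_lt hξ hσ)
    obtain ⟨n, h4, h5, h6, h7, h8⟩ := (hcon.and_eventually (hσ'.and ((hle σ (max ξ σ + 1)
      ((le_max_right _ _).trans (lt_add_one _).le) h3).and ((hh2 ξ hξ).and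
        (hξ' (max ξ σ + 1) ((le_max_left _ _).trans_lt (lt_add_one _)) h3))))).exists
    exact h8 _ ((hg n h7).2.2 h4) ⟨(hg n h7).2.1, h5.trans_le h6⟩
  have hℵ1 : ℵ_ 1 < μ := by rw [← succ_aleph0]; exact hlim _ hμ
  have hcμ : ∀ n, (h n).cof < μ := by
    intro n
    refine lt_of_le_of_lt (Ordinal.cof_le_card _) (lt_of_le_of_lt (Ordinal.card_le_card (hh1 n)) ?_)
    rw [card_ord]; exact hlim _ (hm2 n)
  obtain ⟨φ, hφ1, hφ2⟩ := exists_seq_of_forall_finset_exists (fun n => ℵ_ 1 < (h n).cof)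
    (fun n n' => n < n' ∧ (h n).cof < (h n').cof) (by
      intro s _
      have h1 : ∀ᶠ n' in atTop, ∀ n ∈ s, n < n' ∧ (h n).cof < (h n').cof := by
        rw [eventually_all_finset]
        intro n _
        exact (eventually_gt_atTop n).and (hcofh _ (hcμ n))
      exact ((hcofh _ hℵ1).and h1).exists)
  have hφm : StrictMono φ := fun a b hab => (hφ2 a b hab).1
  have hφt : Tendsto φ atTop atTop := hφm.tendsto_atTop
  classical
  let f' : Ordinal.{0} → ℕ → Ordinal.{0} := fun ξ k =>
    if f ξ (φ k) < h (φ k) then sInf {j | f ξ (φ k) ≤ e (h (φ k)) j} else 0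
  have hf'lt : ∀ ξ k, f' ξ k < ((h (φ k)).cof).ord := by
    intro ξ k
    by_cases h1 : f ξ (φ k) < h (φ k)
    · simp only [f', h1, if_true]
      obtain ⟨j, hj, hj'⟩ := he3 _ _ h1
      exact lt_of_le_of_lt (csInf_le' hj') hj
    · simp only [f', h1, if_false]
      rw [← ord_zero, ord_lt_ord]
      exact bot_le.trans_lt (hφ1 k)
  have hf'sp : ∀ ξ k, f ξ (φ k) < h (φ k) → f ξ (φ k) ≤ e (h (φ k)) (f' ξ k) := by
    intro ξ k h1
    simp only [f', h1, if_true]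
    obtain ⟨j, hj, hj'⟩ := he3 _ _ h1
    exact csInf_mem (s := {j | f ξ (φ k) ≤ e (h (φ k)) j}) ⟨j, hj'⟩
  refine ⟨fun k => (h (φ k)).cof, f', ?_, ?_, hφ1, fun k => hcμ _, ?_, hf'lt, ?_, ?_⟩
  · intro k
    refine isRegular_cof (Ordinal.aleph0_le_cof.mp ?_)
    exact (aleph0_le_aleph 1).trans (hφ1 k).le
  · exact fun a b hab => (hφ2 a b hab).2
  · intro c hc
    exact (hφt.eventually (hcofh c hc)).exists
  · intro ξ ξ' h1 h2
    filter_upwards [hφt.eventually (hle ξ ξ' h1 h2), hφt.eventually (hh2 ξ' h2)] with k h3 h4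
    have h5 := h3.trans_lt h4
    have h6 := hf'sp ξ' k h4
    show f' ξ k ≤ _
    simp only [f', h5, if_true] 
    exact csInf_le' (h3.trans h6)
  · intro g hg
    have hinj := hφm.injective
    obtain ⟨σ, hσ, hσ'⟩ := hh3 (Function.extend φ (fun k => e (h (φ k)) (g k)) (f 0)) (by
      filter_upwards [hh2 0 hΛ.ord_pos] with n hn
      by_cases hr : ∃ k, φ k = n
      · obtain ⟨k, rfl⟩ := hr
        rw [hinj.extend_apply]; exact he1 _ _ (hg k)
      · rwa [Function.extend_apply' _ _ _ hr])
    refine ⟨σ, hσ, ?_⟩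
    filter_upwards [hφt.eventually hσ', hφt.eventually (hh2 σ hσ)] with k h1 h2
    rw [hinj.extend_apply] at h1
    have h3 := h1.trans_le (hf'sp σ k h2)
    by_contra hc; push Not at hc
    rcases hc.eq_or_lt with h4 | h4
    · rw [h4] at h3; exact lt_irrefl _ h3
    · exact absurd (he2 _ _ (hg k) _ h4) (not_lt.mpr h3.le)


end

section
open Order Filter

def Cov (μ κ ρ : Cardinal.{0}) : Prop :=
  ∃ P : Ordinal.{0} → Set Ordinal.{0}, (∀ ζ, #(P ζ) ≤ lift.{1,0} κ) ∧
    ∀ X : Set Ordinal.{0}, X ⊆ Iio μ.ord → #X ≤ lift.{1,0} κ → ∃ ζ < ρ.ord, X ⊆ P ζ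

lemma mk_Iio_ord (c : Cardinal.{0}) : #(Iio c.ord) = lift.{1,0} c := by rw [mk_Iio_ordinal, card_ord]

lemma cov_of_index {I : Type 1} {μ κ ρ : Cardinal.{0}} (hI : #I ≤ lift.{1,0} ρ)
    (P : I → Set Ordinal.{0}) (h1 : ∀ i, #(P i) ≤ lift.{1,0} κ)
    (h2 : ∀ X : Set Ordinal.{0}, X ⊆ Iio μ.ord → #X ≤ lift.{1,0} κ → ∃ i, X ⊆ P i) :
    Cov μ κ ρ := by
  classical
  rw [← mk_Iio_ord] at hI
  obtain ⟨φ⟩ := hI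
  refine ⟨fun ζ => if h : ∃ i, (φ i : Ordinal) = ζ then P h.choose else ∅, ?_, ?_⟩
  · intro ζ
    by_cases h : ∃ i, (φ i : Ordinal) = ζ
    · simp only [h, dif_pos]; exact h1 _
    · simp [h]
  · intro X hX hX'
    obtain ⟨i, hi⟩ := h2 X hX hX'
    refine ⟨φ i, (φ i).2, ?_⟩
    have h : ∃ i', (φ i' : Ordinal) = φ i := ⟨i, rfl⟩
    simp only [h, dif_pos]
    have : h.choose = i := φ.injective (Subtype.ext h.choose_spec)
    rw [this]; exact hi

lemma mk_bUnion_le' {α β : Type 1} {κ : Cardinal.{0}} (hκ : ℵ₀ ≤ κ) {I : Set α} {P : α → Set β}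
    (hI : #I ≤ lift.{1,0} κ) (hP : ∀ i ∈ I, #(P i) ≤ lift.{1,0} κ) :
    #(⋃ i ∈ I, P i) ≤ lift.{1,0} κ := by
  refine (mk_biUnion_le P I).trans ?_
  have hκ' : ℵ₀ ≤ lift.{1,0} κ := by simpa using hκ
  refine (mul_le_mul' hI (ciSup_le' fun i : I => hP i i.2)).trans ?_
  rw [mul_eq_self hκ']

def Ev (θ : Ordinal.{0}) (p : Ordinal.{0} → Prop) : Prop := ∃ i0 < θ, ∀ i, i0 ≤ i → i < θ → p i

lemma BPo {μ θ : Cardinal.{0}} (hθ : θ.IsRegular)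
    (m : Ordinal.{0} → Cardinal.{0}) (hμ : ℵ₀ ≤ μ) (hs : μ.ord.cof < μ) (hlim : ∀ k < μ, succ k < μ)
    (hm : ∀ i, ℵ₀ ≤ m i) (hm2 : ∀ k < μ, Ev θ.ord fun i => k ≤ m i) (hι : θ < μ) :
    ∃ f : Ordinal.{0} → Ordinal.{0} → Ordinal.{0}, (∀ ξ, ∀ i, f ξ i < (succ (m i)).ord) ∧
      (∀ α ξ, α < ξ → ξ < (succ μ).ord → Ev θ.ord fun i => f α i < f ξ i) ∧
      ∀ κ < μ, ∀ S : Ordinal.{0} → Set Ordinal.{0}, (∀ i, #(S i) ≤ lift.{1,0} κ) →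
        ∃ ξ < (succ μ).ord, ∀ ξ', ξ < ξ' → ξ' < (succ μ).ord →
          Ev θ.ord fun i => ∀ s ∈ S i, ¬ (f ξ i ≤ s ∧ s < f ξ' i) := by
  classical
  have := noMaxOrder hθ.aleph0_le
  have hne : Nonempty θ.ord.ToType := ⟨Ordinal.ToType.mk ⟨0, hθ.ord_pos⟩⟩
  have hev : ∀ p : Ordinal.{0} → Prop,
      (∀ᶠ i : θ.ord.ToType in atTop, p ((Ordinal.ToType.mk.symm i : Iio θ.ord) : Ordinal)) ↔ Ev θ.ord p := by
    intro p
    rw [eventually_atTop]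
    constructor
    · rintro ⟨a, ha⟩
      refine ⟨(Ordinal.ToType.mk.symm a : Iio θ.ord), (Ordinal.ToType.mk.symm a : Iio θ.ord).2, fun i hi hi' => ?_⟩
      have := ha (Ordinal.ToType.mk ⟨i, hi'⟩) ((OrderIso.symm_apply_le _).mp (show _ ≤ (⟨i, hi'⟩ : Iio θ.ord) from hi))
      simpa using this
    · rintro ⟨i0, hi0, h⟩
      refine ⟨Ordinal.ToType.mk ⟨i0, hi0⟩, fun b hb => h _ ?_ (Ordinal.ToType.mk.symm b : Iio θ.ord).2⟩
      exact (OrderIso.le_symm_apply _).mpr hb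
  obtain ⟨f, hf1, hf2, hf3⟩ := BP (ι := θ.ord.ToType)
    (fun i => m ((Ordinal.ToType.mk.symm i : Iio θ.ord) : Ordinal)) hμ hs hlim (fun i => hm _)
    (fun k hk => (hev _).mpr (hm2 k hk)) (by rwa [mk_ord_toType])
  let f' : Ordinal.{0} → Ordinal.{0} → Ordinal.{0} := fun ξ i =>
    if h : i < θ.ord then f ξ (Ordinal.ToType.mk ⟨i, h⟩) else 0
  have hff : ∀ ξ (i : θ.ord.ToType), f ξ i = f' ξ ((Ordinal.ToType.mk.symm i : Iio θ.ord) : Ordinal) := by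
    intro ξ i
    have : ((Ordinal.ToType.mk.symm i : Iio θ.ord) : Ordinal) < θ.ord := (Ordinal.ToType.mk.symm i : Iio θ.ord).2
    simp only [f', this, dif_pos]
    exact congrArg (f ξ) (OrderIso.apply_symm_apply _ i).symm
  refine ⟨f', ?_, ?_, ?_⟩
  · intro ξ i
    by_cases h : i < θ.ord
    · simp only [f', h, dif_pos]
      have := hf1 ξ (Ordinal.ToType.mk ⟨i, h⟩)
      simpa using this
    · simp only [f', h, dif_neg, not_false_eq_true]
      exact (isRegular_succ (hm i)).ord_pos
  · intro α ξ h1 h2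
    rw [← hev]
    simpa only [hff] using hf2 α ξ h1 h2
  · intro κ hκ S hS
    obtain ⟨ξ, hξ, h⟩ := hf3 κ hκ (fun i => S ((Ordinal.ToType.mk.symm i : Iio θ.ord) : Ordinal)) (fun i => hS _)
    refine ⟨ξ, hξ, fun ξ' h1 h2 => ?_⟩
    rw [← hev]
    simpa only [hff] using h ξ' h1 h2

lemma Ev.and {θ : Ordinal.{0}} {p q : Ordinal.{0} → Prop} (hp : Ev θ p) (hq : Ev θ q) :
    Ev θ fun i => p i ∧ q i := by
  obtain ⟨a, ha, h1⟩ := hp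
  obtain ⟨b, hb, h2⟩ := hq
  exact ⟨max a b, max_lt ha hb, fun i hi hi' => ⟨h1 i ((le_max_left _ _).trans hi) hi', h2 i ((le_max_right _ _).trans hi) hi'⟩⟩

def St (θ : Cardinal.{0}) (A : Ordinal.{0} → Prop) : Prop :=
  ∀ Φ : Ordinal.{0} → Ordinal.{0}, (∀ x < θ.ord, Φ x < θ.ord) → ∃ i < θ.ord, A i ∧ i ≠ 0 ∧ Cl Φ i

lemma press {θ : Cardinal.{0}} (hθ : θ.IsRegular) {A : Ordinal.{0} → Prop} (hA : St θ A)
    {M v : Ordinal.{0} → Ordinal.{0}} 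
    (hM : ∀ i < θ.ord, i ≠ 0 → (∀ j < i, j + 1 < i) → ∀ x < M i, ∃ j < i, x < M j)
    (hv : ∀ i < θ.ord, A i → v i < M i) :
    ∃ j < θ.ord, ∀ b < θ.ord, ∃ i < θ.ord, b ≤ i ∧ A i ∧ v i < M j := by
  by_contra hc
  push Not at hc
  have hl := isSuccLimit_ord hθ.aleph0_le
  choose! b hb1 hb2 using hc
  obtain ⟨i, hi, hAi, hi0, hcl⟩ := hA (fun j => max (j + 1) (b j))
    (fun x hx => max_lt (hl.add_one_lt hx) (hb1 x hx))
  obtain ⟨j, hj, hlt⟩ := hM i hi hi0 (fun j hj => (le_max_left _ _).trans_lt (hcl j hj)) _ (hv i hi hAi)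
  exact absurd hlt (not_lt.mpr (hb2 j (hj.trans hi) i hi ((le_max_right _ _).trans (hcl j hj).le) hAi))

lemma exists_inj {c : Cardinal.{0}} {ζ : Ordinal.{0}} (hζ : ζ < (succ c).ord) :
    ∃ g : Ordinal.{0} → Ordinal.{0}, (∀ x < ζ, g x < c.ord) ∧ ∀ x < ζ, ∀ y < ζ, g x = g y → x = y := by
  classical
  have : #(Iio ζ) ≤ #(Iio c.ord) := by
    rw [mk_Iio_ord, mk_Iio_ordinal, Cardinal.lift_le]
    exact lt_succ_iff.mp (lt_ord.mp hζ)
  obtain ⟨φ⟩ := this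
  refine ⟨fun x => if h : x < ζ then φ ⟨x, h⟩ else 0, ?_, ?_⟩
  · intro x hx; simp only [hx, dif_pos]; exact (φ ⟨x, hx⟩).2
  · intro x hx y hy h
    simp only [hx, hy, dif_pos] at h
    have := φ.injective (Subtype.ext h)
    exact congrArg Subtype.val this

theorem silver {μ κ : Cardinal.{0}} (hκ : ℵ₀ ≤ κ) (hκμ : κ < μ) (hlim : ∀ k < μ, succ k < μ)
    (hunc : ℵ₀ < μ.ord.cof) (hcofκ : μ.ord.cof ≤ κ)
    (IH : ∀ c < μ, κ < c → Cov c κ (succ c)) : Cov μ κ (succ μ) := by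
  have hμ : ℵ₀ ≤ μ := hκ.trans hκμ.le
  have hΛ : (succ μ).IsRegular := isRegular_succ hμ
  have hΛl := isSuccLimit_ord hΛ.aleph0_le
  obtain ⟨θ, hθ⟩ : ∃ θ, θ = μ.ord.cof := ⟨_, rfl⟩
  have hθr : θ.IsRegular := hθ ▸ isRegular_cof (isSuccLimit_ord hμ)
  obtain ⟨e, he1, he2, he3⟩ := exists_cof_seq μ.ord
  rw [← hθ] at hunc hcofκ he1 he2 he3
  have hθl := isSuccLimit_ord hθr.aleph0_le
  let mc : Ordinal.{0} → Cardinal.{0} := fun i =>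
    max (succ κ) (sSup (range fun j : Iio i => succ (e j).card))
  have hmc1 : ∀ i, κ < mc i := fun i => (lt_succ κ).trans_le (le_max_left _ _)
  have hstep : ∀ j i, j < i → succ (e j).card ≤ mc i := fun j i h =>
    le_max_of_le_right (le_csSup bddAbove_of_small ⟨⟨j, h⟩, rfl⟩)
  have hmcμ : ∀ i < θ.ord, mc i < μ := by
    intro i hi
    refine max_lt (hlim _ hκμ) (lt_of_le_of_lt (csSup_le' (a := succ (e i).card) ?_) (hlim _ (lt_ord.mp (he1 i hi))))
    rintro _ ⟨j, rfl⟩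
    exact succ_le_succ (Ordinal.card_le_card (he2 i hi j j.2).le)
  have hmcmono : ∀ i j, i ≤ j → mc i ≤ mc j := by
    intro i j h
    refine max_le (le_max_left _ _) (csSup_le' ?_)
    rintro _ ⟨l, rfl⟩
    exact hstep _ _ (lt_of_lt_of_le l.2 h)
  have hmccof : ∀ k < μ, Ev θ.ord fun i => k ≤ mc i := by
    intro k hk
    obtain ⟨j, hj, h⟩ := he3 k.ord (ord_lt_ord.mpr hk)
    refine ⟨j + 1, hθl.add_one_lt hj, fun i hi _ => ?_⟩
    exact (ord_le.mp h).trans ((le_succ _).trans (hstep j i (lt_of_lt_of_le (lt_add_one j) hi)))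
  have hcont : ∀ i < θ.ord, i ≠ 0 → (∀ j < i, j + 1 < i) → ∀ x < (mc i).ord, ∃ j < i, x < (mc j).ord := by
    intro i _ hi0 hil x hx
    rw [lt_ord] at hx
    rcases lt_max_iff.mp hx with h | h
    · refine ⟨0, pos_iff_ne_zero.mpr hi0, ?_⟩
      rw [lt_ord]; exact h.trans_le (le_max_left _ _)
    · by_contra hc
      push Not at hc
      refine absurd h (not_lt.mpr (csSup_le' ?_))
      rintro _ ⟨j, rfl⟩
      have := hc (j + 1) (hil j j.2)
      rw [ord_le] at this
      exact (hstep _ _ (lt_add_one (j : Ordinal))).trans this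
  have hsing : μ.ord.cof < μ := by rw [← hθ]; exact hcofκ.trans_lt hκμ
  have hθμ : θ < μ := hθ ▸ hsing
  obtain ⟨f, hf1, hf2, hf3⟩ := BPo hθr mc hμ hsing hlim (fun i => hκ.trans (hmc1 i).le) hmccof hθμ
  have hP : ∀ i, ∃ P : Ordinal.{0} → Set Ordinal.{0}, (∀ ζ, #(P ζ) ≤ lift.{1,0} κ) ∧ (i < θ.ord →
      ∀ X : Set Ordinal.{0}, X ⊆ Iio (mc i).ord → #X ≤ lift.{1,0} κ → ∃ ζ < (succ (mc i)).ord, X ⊆ P ζ) := by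
    intro i
    by_cases hi : i < θ.ord
    · obtain ⟨P, h1, h2⟩ := IH (mc i) (hmcμ i hi) (hmc1 i)
      exact ⟨P, h1, fun _ => h2⟩
    · exact ⟨fun _ => ∅, by simp, fun h => absurd h hi⟩
  choose P hP1 hP2 using hP
  have hinj : ∀ i ζ, ∃ g : Ordinal.{0} → Ordinal.{0}, ζ < (succ (mc i)).ord →
    (∀ x < ζ, g x < (mc i).ord) ∧ ∀ x < ζ, ∀ y < ζ, g x = g y → x = y := by
    intro i ζ
    by_cases h : ζ < (succ (mc i)).ord
    · obtain ⟨g, hg⟩ := exists_inj h; exact ⟨g, fun _ => hg⟩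
    · exact ⟨id, fun h' => absurd h' h⟩
  choose inj hinj using hinj
  have hmcl : ∀ i, IsSuccLimit (succ (mc i)).ord := fun i =>
    isSuccLimit_ord (hκ.trans ((hmc1 i).le.trans (le_succ _)))
  refine cov_of_index (I := Iio (succ μ).ord × Iio θ.ord × Iio (succ μ).ord) ?_
    (fun t => ⋃ i ∈ Iio θ.ord, ⋃ ζ ∈ {ζ | ζ < f t.1 i ∧ inj i (f t.1 i) ζ ∈ P t.2.1 t.2.2}, P i ζ) ?_ ?_
  · have h1 : ℵ₀ ≤ lift.{1,0} (succ μ) := aleph0_le_lift.mpr hΛ.aleph0_le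
    simp only [mk_prod, Cardinal.lift_id, mk_Iio_ord]
    refine (mul_le_mul' le_rfl (mul_le_mul' (Cardinal.lift_le.mpr (hθμ.le.trans (le_succ μ))) le_rfl)).trans ?_
    rw [mul_eq_self h1, mul_eq_self h1]
  · rintro ⟨ξ, j, η⟩
    refine mk_bUnion_le' hκ ?_ fun i hi => mk_bUnion_le' hκ ?_ fun ζ _ => hP1 _ _
    · rw [mk_Iio_ord, Cardinal.lift_le]; exact hcofκ
    · refine le_trans ?_ (hP1 j η)
      refine mk_le_of_injective (f := fun z : {ζ | ζ < f ξ i ∧ inj i (f ξ i) ζ ∈ P j η} =>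
        (⟨inj i (f ξ i) z, z.2.2⟩ : P j η)) ?_
      rintro ⟨x, hx⟩ ⟨y, hy⟩ hxy
      simp only [Subtype.mk.injEq] at hxy ⊢
      exact (hinj i (f ξ i) (hf1 ξ i)).2 x hx.1 y hy.1 hxy
  · intro X hX hXκ
    have hF : ∀ i, ∃ ζ, i < θ.ord → ζ < (succ (mc i)).ord ∧ X ∩ Iio (mc i).ord ⊆ P i ζ := by
      intro i
      by_cases hi : i < θ.ord
      · obtain ⟨ζ, h1, h2⟩ := hP2 i hi (X ∩ Iio (mc i).ord) inter_subset_right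
          ((mk_le_mk_of_subset inter_subset_left).trans hXκ)
        exact ⟨ζ, fun _ => ⟨h1, h2⟩⟩
      · exact ⟨0, fun h => absurd h hi⟩
    choose F hF using hF
    have claim : ∃ ξ < (succ μ).ord, St θ fun i => F i < f ξ i := by
      by_contra hc
      push Not at hc
      have hW : ∀ ξ < (succ μ).ord, ∃ j < θ.ord, ∀ b < θ.ord, ∃ i < θ.ord, b ≤ i ∧ f ξ i ≤ F i ∧
          inj i (F i + 1) (f ξ i) < (mc j).ord := by
        intro ξ hξ
        have h0 := hc ξ hξ
        unfold St at h0
        push Not at h0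
        obtain ⟨Φ, hΦ, hΦ'⟩ := h0
        have hst : St θ fun i => f ξ i ≤ F i := by
          intro Ψ hΨ
          obtain ⟨i, hi, hi0, hcl, _⟩ := exists_cl (Φ := fun x => max (Φ x) (Ψ x)) hθr
            (fun x hx => max_lt (hΦ x hx) (hΨ x hx)) hθr.ord_pos isRegular_aleph0 hunc
          refine ⟨i, hi, ?_, hi0.ne', fun x hx => (le_max_right _ _).trans_lt (hcl x hx)⟩
          by_contra h1
          push Not at h1
          exact hΦ' i hi h1 hi0.ne' fun x hx => (le_max_left _ _).trans_lt (hcl x hx)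
        obtain ⟨j, hj, hj'⟩ := press hθr hst (M := fun i => (mc i).ord) (v := fun i => inj i (F i + 1) (f ξ i)) hcont
          (fun i hi h1 => (hinj i (F i + 1) ((hmcl i).add_one_lt (hF i hi).1)).1 _ (lt_of_le_of_lt h1 (lt_add_one _)))
        exact ⟨j, hj, hj'⟩
      choose! jf hj1 hj2 using hW
      have hunb : ∃ j < θ.ord, ∀ β < (succ μ).ord, ∃ ξ < (succ μ).ord, β < ξ ∧ jf ξ = j := by
        by_contra hc2
        push Not at hc2
        choose! β hβ1 hβ2 using hc2
        have hb : ls (β '' Iio θ.ord) < (succ μ).ord :=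
          lsI_lt hΛ (ord_lt_ord.mpr (hθμ.trans (lt_succ μ))) hβ1
        have h1 := hj1 _ hb
        exact hβ2 _ h1 _ hb (lt_ls ⟨_, h1, rfl⟩) rfl
      obtain ⟨j, hj, hjW⟩ := hunb
      obtain ⟨ξ0, hξ0, h0⟩ := hf3 (mc j) (hmcμ j hj)
        (fun i => {ζ | i < θ.ord ∧ ζ ≤ F i ∧ inj i (F i + 1) ζ < (mc j).ord}) (by
          intro i
          rw [← mk_Iio_ord]
          refine mk_le_of_injective (f := fun z : {ζ | i < θ.ord ∧ ζ ≤ F i ∧ inj i (F i + 1) ζ < (mc j).ord} =>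
            (⟨inj i (F i + 1) z, z.2.2.2⟩ : Iio (mc j).ord)) ?_
          rintro ⟨x, hx⟩ ⟨y, hy⟩ hxy
          simp only [Subtype.mk.injEq]
          exact (hinj i (F i + 1) ((hmcl i).add_one_lt (hF i hx.1).1)).2 x
            (lt_of_le_of_lt hx.2.1 (lt_add_one _)) y (lt_of_le_of_lt hy.2.1 (lt_add_one _)) (congrArg Subtype.val hxy))
      obtain ⟨ξ1, hξ1, h01, hjξ1⟩ := hjW ξ0 hξ0
      have hξ2 := hΛl.add_one_lt hξ1
      obtain ⟨b, hb, hb'⟩ := ((h0 (ξ1 + 1) (h01.trans (lt_add_one _)) hξ2).and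
        (hf2 ξ0 ξ1 h01 hξ1)).and (hf2 ξ1 (ξ1 + 1) (lt_add_one _) hξ2)
      obtain ⟨i, hi, hbi, h3, h4⟩ := hj2 ξ1 hξ1 b hb
      rw [hjξ1] at h4
      obtain ⟨⟨h5, h6⟩, h7⟩ := hb' i hbi hi
      exact h5 _ ⟨hi, h3, h4⟩ ⟨h6.le, h7⟩
    obtain ⟨ξ, hξ, hst⟩ := claim
    obtain ⟨j, hj, hj'⟩ := press hθr hst (M := fun i => (mc i).ord) (v := fun i => inj i (f ξ i) (F i)) hcont
      (fun i hi h1 => (hinj i (f ξ i) (hf1 ξ i)).1 _ h1)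
    obtain ⟨η, hη, hY⟩ := hP2 j hj
      (((fun i => inj i (f ξ i) (F i)) '' Iio θ.ord) ∩ Iio (mc j).ord) inter_subset_right
      ((mk_le_mk_of_subset inter_subset_left).trans (mk_image_le.trans
        (by rw [mk_Iio_ord, Cardinal.lift_le]; exact hcofκ)))
    have hηΛ : η < (succ μ).ord := hη.trans_le (ord_le_ord.mpr (succ_le_succ (hmcμ j hj).le))
    refine ⟨⟨⟨ξ, hξ⟩, ⟨j, hj⟩, ⟨η, hηΛ⟩⟩, ?_⟩
    intro x hx
    obtain ⟨i0, hi0, h1⟩ := hmccof (succ x.card) (hlim _ (lt_ord.mp (hX hx)))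
    obtain ⟨i, hi, hi0i, h2, h3⟩ := hj' i0 hi0
    have h4 : x < (mc i).ord := lt_ord.mpr ((lt_succ _).trans_le (h1 i hi0i hi))
    simp only [mem_iUnion]
    exact ⟨i, hi, F i, ⟨h2, hY ⟨⟨i, hi, rfl⟩, h3⟩⟩, (hF i hi).2 ⟨hx, h4⟩⟩


end

section
open Order Filter

lemma exists_seqω {σ : Ordinal.{0}} (h : σ.cof = ℵ₀) : ∃ t : ℕ → Ordinal.{0}, StrictMono t ∧ (∀ n, t n < σ) ∧
    ∀ x < σ, ∃ n, x ≤ t n := by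
  obtain ⟨e, h1, h2, h3⟩ := exists_cof_seq σ
  rw [h, ord_aleph0] at h1 h2 h3
  refine ⟨fun n => e n, fun a b hab => h2 b (Ordinal.natCast_lt_omega0 b) a (by exact_mod_cast hab),
    fun n => h1 n (Ordinal.natCast_lt_omega0 n), fun x hx => ?_⟩
  obtain ⟨j, hj, hj'⟩ := h3 x hx
  obtain ⟨n, rfl⟩ := Ordinal.lt_omega0.mp hj
  exact ⟨n, hj'⟩

lemma solovay {Λ : Cardinal.{0}} (hΛ : Λ.IsRegular) (h1 : ℵ_ 1 < Λ) :
    ∃ h : Ordinal.{0} → Ordinal.{0}, (∀ σ, h σ < (ℵ_ 1).ord) ∧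
    ∀ γ < (ℵ_ 1).ord, ∀ Φ : Ordinal.{0} → Ordinal.{0}, (∀ x < Λ.ord, Φ x < Λ.ord) →
      ∃ σ < Λ.ord, σ.cof = ℵ₀ ∧ Cl Φ σ ∧ γ ≤ h σ := by
  classical
  have h0 : ℵ₀ < Λ := (aleph0_lt_aleph_one).trans h1
  have ht : ∀ σ : Ordinal.{0}, ∃ t : ℕ → Ordinal.{0}, σ.cof = ℵ₀ → (∀ n, t n < σ) ∧
    ∀ x < σ, ∃ n, x ≤ t n := by
    intro σ
    by_cases h : σ.cof = ℵ₀
    · obtain ⟨t, _, h2⟩ := exists_seqω h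
      exact ⟨t, fun _ => h2⟩
    · exact ⟨fun _ => 0, fun h' => absurd h' h⟩
  choose t ht using ht
  have hk : ∃ k, ∀ β < Λ.ord, ∀ Φ : Ordinal.{0} → Ordinal.{0}, (∀ x < Λ.ord, Φ x < Λ.ord) →
      ∃ σ < Λ.ord, σ.cof = ℵ₀ ∧ Cl Φ σ ∧ β ≤ t σ k := by
    by_contra hc
    push Not at hc
    choose β hβ Φ hΦ hno using hc
    have hb : ls (range β) < Λ.ord := lsr_lt hΛ (by simpa using h0) hβ
    obtain ⟨σ, hσ, hbσ, hcl, hcof⟩ := exists_cl (Φ := fun x => ls (range fun k => Φ k x)) hΛ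
      (fun x hx => lsr_lt hΛ (by simpa using h0) fun k => hΦ k x hx) hb isRegular_aleph0 h0
    obtain ⟨k, hk⟩ := (ht σ hcof).2 _ hbσ
    refine absurd (hno k σ hσ hcof fun x hx => ?_) (not_lt.mpr ((lt_ls (mem_range_self k)).le.trans hk))
    exact (lt_ls (X := range fun k => Φ k x) ⟨k, rfl⟩).trans (hcl x hx)
  obtain ⟨k, hk⟩ := hk
  have hη : ∀ β < Λ.ord, ∃ η < Λ.ord, β ≤ η ∧ ∀ Φ : Ordinal.{0} → Ordinal.{0}, (∀ x < Λ.ord, Φ x < Λ.ord) →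
      ∃ σ < Λ.ord, σ.cof = ℵ₀ ∧ Cl Φ σ ∧ t σ k = η := by
    intro β hβ
    by_contra hc
    push Not at hc
    choose! Φ hΦ hno using hc
    let Ψ : Ordinal.{0} → Ordinal.{0} → Ordinal.{0} := fun η x => if η < Λ.ord ∧ β ≤ η then Φ η x else 0
    have hΨ : ∀ η x, x < Λ.ord → Ψ η x < Λ.ord := by
      intro η x hx
      by_cases h : η < Λ.ord ∧ β ≤ η
      · simp only [Ψ, h]; exact hΦ η h.1 h.2 x hx
      · simp only [Ψ, h]; exact hΛ.ord_pos
    obtain ⟨σ, hσ, hcof, hcl, hle⟩ := hk β hβ (fun α => ls ((fun η => maj (Ψ η) α) '' Iio (α + 1))) (fun x hx =>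
      lsI_lt hΛ (succ_lt_reg hΛ.aleph0_le hx) fun η _ => maj_lt hΛ (hΨ η) hx)
    have hlt := (ht σ hcof).1 k
    refine hno (t σ k) (hlt.trans hσ) hle σ hσ hcof (fun x hx => ?_) rfl
    have h2 : Ψ (t σ k) x = Φ (t σ k) x := by simp [Ψ, hlt.trans hσ, hle]
    rw [← h2]
    refine lt_trans ?_ (hcl (max x (t σ k)) (max_lt hx hlt))
    refine (le_maj (le_max_left x (t σ k))).trans (lt_ls (X := (fun η => maj (Ψ η) (max x (t σ k))) '' Iio _) ⟨t σ k, ?_, rfl⟩)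
    exact show t σ k < max x (t σ k) + 1 from lt_of_le_of_lt (le_max_right _ _) (lt_add_one _)
  choose! e he1 he2 he3 using hη
  let b : Ordinal.{0} → Ordinal.{0} := fun γ => itr (fun x => e x + 1) 0 γ
  have hb : ∀ γ < (ℵ_ 1).ord, b γ < Λ.ord := fun γ hγ =>
    itr_lt hΛ hΛ.ord_pos (fun x hx => succ_lt_reg hΛ.aleph0_le (he1 x hx)) (hγ.trans (ord_lt_ord.mpr h1))
  have hlt : ∀ γ' < (ℵ_ 1).ord, ∀ γ < γ', e (b γ) < e (b γ') := fun γ' h γ h' =>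
    lt_of_lt_of_le (lt_of_lt_of_le (lt_add_one _) (itr_step (Φ := fun x => e x + 1) h')) (he2 _ (hb _ h))
  refine ⟨fun σ => if h : ∃ γ < (ℵ_ 1).ord, t σ k = e (b γ) then h.choose else 0, ?_, ?_⟩
  · intro σ
    by_cases h : ∃ γ < (ℵ_ 1).ord, t σ k = e (b γ)
    · simp only [h, dif_pos]; exact h.choose_spec.1
    · simp only [h, dif_neg, not_false_eq_true]; exact isRegular_aleph_one.ord_pos
  · intro γ hγ Φ hΦ
    obtain ⟨σ, hσ, hcof, hcl, hh⟩ := he3 (b γ) (hb γ hγ) Φ hΦ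
    refine ⟨σ, hσ, hcof, hcl, ?_⟩
    have h : ∃ γ < (ℵ_ 1).ord, t σ k = e (b γ) := ⟨γ, hγ, hh⟩
    simp only [h, dif_pos]
    by_contra hc
    push Not at hc
    have := hlt _ hγ _ hc
    rw [← h.choose_spec.2, ← hh] at this
    exact lt_irrefl _ this


end

section
open Order Filter

def pre {U : Type*} (u : ℕ → U) (n : ℕ) : List U := (List.range n).map u

lemma pre_succ {U : Type*} (u : ℕ → U) (n : ℕ) : pre u (n + 1) = pre u n ++ [u n] := by
  simp [pre, List.range_succ]
lemma pre_len {U : Type*} (u : ℕ → U) (n : ℕ) : (pre u n).length = n := by simp [pre]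
lemma pre_get {U : Type*} (u : ℕ → U) (n m : ℕ) (h : m < (pre u n).length) : (pre u n)[m] = u m := by
  simp [pre]
lemma pre_inj {U : Type*} {u v : ℕ → U} {n m : ℕ} (h : pre u n = pre v n) (hm : m < n) : u m = v m := by
  have := List.map_inj_left.mp h m (by simpa using hm)
  exact this
lemma pre_congr {U : Type*} {u v : ℕ → U} {n : ℕ} (h : ∀ m < n, u m = v m) : pre u n = pre v n := by
  refine List.map_inj_left.mpr fun m hm => h m (by simpa using hm)

lemma game {U : Type*} (lam : ℕ → Ordinal.{0}) (hlam : ∀ n, 0 < lam n) (val : U → Ordinal.{0})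
    (Lg : ℕ → U → Prop) (W : Set (ℕ → U))
    (hW : ∀ u, (∀ n, ∃ w ∈ W, pre w n = pre u n) → u ∈ W)
    (hyp : ∀ b : List U → Ordinal.{0}, (∀ l, b l < lam l.length) →
      ∃ u ∈ W, ∀ n, Lg n (u n) ∧ b (pre u n) < val (u n)) :
    ∃ 𝒢 : Set (List U), [] ∈ 𝒢 ∧
      (∀ l ∈ 𝒢, ∀ β < lam l.length, ∃ u, Lg l.length u ∧ β < val u ∧ l ++ [u] ∈ 𝒢) ∧
      ∀ u, (∀ n, pre u n ∈ 𝒢) → u ∈ W := by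
  classical
  refine ⟨{l | ∀ b : List U → Ordinal.{0}, (∀ l, b l < lam l.length) →
    ∃ u ∈ W, pre u l.length = l ∧ ∀ n ≥ l.length, Lg n (u n) ∧ b (pre u n) < val (u n)}, ?_, ?_, ?_⟩
  · intro b hb
    obtain ⟨u, hu, h⟩ := hyp b hb
    exact ⟨u, hu, rfl, fun n _ => h n⟩
  · intro l hl β hβ
    by_contra hc
    push Not at hc
    have hc' : ∀ u, ∃ b : List U → Ordinal.{0}, (∀ l, b l < lam l.length) ∧
        (Lg l.length u → β < val u → ¬ ∃ w ∈ W, pre w (l ++ [u]).length = l ++ [u] ∧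
          ∀ n ≥ (l ++ [u]).length, Lg n (w n) ∧ b (pre w n) < val (w n)) := by
      intro u
      by_cases h : Lg l.length u ∧ β < val u
      · have := hc u h.1 h.2
        rw [mem_ofPred_eq] at this
        push Not at this
        obtain ⟨b, hb, h2⟩ := this
        refine ⟨b, hb, fun _ _ => ?_⟩
        rintro ⟨w, hw, h3, h4⟩
        obtain ⟨n, hn, h5⟩ := h2 w hw h3
        exact absurd (h4 n hn).2 (not_lt.mpr (h5 (h4 n hn).1))
      · exact ⟨fun _ => 0, fun _ => hlam _, fun h1 h2 => absurd ⟨h1, h2⟩ h⟩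
    choose B hB1 hB2 using hc'
    obtain ⟨w, hw, hwl, hw2⟩ := hl (fun l' => if l' = l then β else
      if h : l.length < l'.length then B (l'[l.length]) l' else 0) (by
        intro l'
        split_ifs with h1 h2
        · rw [h1]; exact hβ
        · exact hB1 _ _
        · exact hlam _)
    have h1 := hw2 l.length le_rfl
    simp only [hwl, if_true] at h1
    refine hB2 (w l.length) h1.1 h1.2 ⟨w, hw, ?_, fun n hn => ⟨(hw2 n ?_).1, ?_⟩⟩
    · rw [List.length_append, List.length_singleton, pre_succ, hwl]
    · simp at hn; omega
    · simp only [List.length_append, List.length_singleton, ge_iff_le] at hn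
      have h2 := (hw2 n (by omega)).2
      have h3 : pre w n ≠ l := by
        intro h; have := congrArg List.length h; rw [pre_len] at this; omega
      have h4 : l.length < (pre w n).length := by rw [pre_len]; omega
      simp only [h3, if_false, h4, dif_pos, pre_get] at h2
      exact h2
  · intro u hu
    apply hW
    intro n
    obtain ⟨w, hw, h, _⟩ := hu n (fun _ => 0) (fun _ => hlam _)
    rw [pre_len] at h
    exact ⟨w, hw, h⟩


end

section
open Order Filter

noncomputable def rk (a : Set Ordinal.{0}) (y : Ordinal.{0}) : Ordinal.{0} :=
  sSup (range fun z : {z // z ∈ a ∧ z < y} => rk a z + 1)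
termination_by y
decreasing_by exact z.2.2

lemma rk_eq (a : Set Ordinal.{0}) (y : Ordinal.{0}) : rk a y = ls (rk a '' (a ∩ Iio y)) := by
  rw [rk, ls]
  congr 1
  ext t
  constructor
  · rintro ⟨z, rfl⟩; exact ⟨_, ⟨z, z.2, rfl⟩, rfl⟩
  · rintro ⟨_, ⟨z, hz, rfl⟩, rfl⟩; exact ⟨⟨z, hz⟩, rfl⟩

lemma small_ctbl {X : Set Ordinal.{0}} (h : X.Countable) : Small.{0} X :=
  small_of_lt (c := ℵ₀) (by simpa using h.le_aleph0)

lemma rk_strict {a : Set Ordinal.{0}} {y z : Ordinal.{0}} (hz : z ∈ a) (h : z < y) : rk a z < rk a y := by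
  conv_rhs => rw [rk_eq]
  have : Small.{0} (a ∩ Iio y : Set Ordinal.{0}) := small_subset inter_subset_right
  exact lt_ls (X := rk a '' (a ∩ Iio y)) ⟨z, ⟨hz, h⟩, rfl⟩

lemma ls_ctbl_lt {X : Set Ordinal.{0}} (h : X.Countable) {c : Cardinal.{0}} (hc : c.IsRegular) (h1 : ℵ₀ < c)
    (hX : ∀ x ∈ X, x < c.ord) : ls X < c.ord :=
  ls_lt hc (h.le_aleph0.trans_lt (by simpa using Cardinal.lift_lt.{0,1}.mpr h1)) hX

lemma rk_lt {a : Set Ordinal.{0}} (ha : a.Countable) (y : Ordinal.{0}) : rk a y < (ℵ_ 1).ord := by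
  induction y using WellFoundedLT.induction with
  | ind y ih =>
    rw [rk_eq]
    refine ls_ctbl_lt ((ha.mono inter_subset_left).image _) isRegular_aleph_one aleph0_lt_aleph_one ?_
    rintro _ ⟨z, hz, rfl⟩
    exact ih z hz.2

noncomputable def chi (lam : ℕ → Cardinal.{0}) (a : Set Ordinal.{0}) (n : ℕ) : Ordinal.{0} :=
  ls (a ∩ Iio (lam n).ord)

def Emb (a : Set Ordinal.{0}) (γ : Ordinal.{0}) : Prop :=
  ∃ φ : Ordinal.{0} → Ordinal.{0}, (∀ x ∈ a, φ x < γ) ∧ ∀ x ∈ a, ∀ y ∈ a, x < y → φ x < φ y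

abbrev UU := Ordinal.{0} × Ordinal.{0} × Ordinal.{0}

def Hs (lam : ℕ → Cardinal.{0}) : ℕ → Set (List UU)
  | 0 => {[]}
  | n + 1 => (fun t : List UU × UU => t.1 ++ [t.2]) ''
      (Hs lam n ×ˢ (Iio (lam n).ord ×ˢ (Iio (lam n).ord ×ˢ Iio (ℵ_ 1).ord)))

lemma mk_Hs {lam : ℕ → Cardinal.{0}} (h1 : ∀ n, ℵ_ 1 < lam n) (hs : StrictMono lam) (n : ℕ) :
    #(Hs lam n) < lift.{1,0} (lam n) := by
  induction n with
  | zero =>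
    simp only [Hs, mk_singleton]
    exact one_lt_aleph0.trans (by simpa using Cardinal.lift_lt.{0,1}.mpr (aleph0_lt_aleph_one.trans (h1 0)))
  | succ n ih =>
    refine mk_image_le.trans_lt (lt_of_le_of_lt ?_ (Cardinal.lift_lt.mpr (hs (Nat.lt_succ_self n))))
    simp only [mk_setProd, mk_Iio_ord]
    have h2 : ℵ₀ ≤ lift.{1,0} (lam n) := aleph0_le_lift.mpr (aleph0_lt_aleph_one.trans (h1 n)).le
    refine (mul_le_mul' ih.le (mul_le_mul' le_rfl (mul_le_mul' le_rfl (Cardinal.lift_le.mpr (h1 n).le)))).trans ?_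
    rw [mul_eq_self h2, mul_eq_self h2, mul_eq_self h2]

def Leg (lam : ℕ → Cardinal.{0}) (n : ℕ) (u : UU) : Prop :=
  u.1 < (lam n).ord ∧ u.2.1 < (lam n).ord ∧ u.2.2 < (ℵ_ 1).ord

lemma pre_mem_Hs {lam : ℕ → Cardinal.{0}} {u : ℕ → UU} (h : ∀ n, Leg lam n (u n)) (n : ℕ) :
    pre u n ∈ Hs lam n := by
  induction n with
  | zero => simp [pre, Hs]
  | succ n ih => rw [pre_succ]; exact ⟨(pre u n, u n), ⟨ih, h n⟩, rfl⟩

lemma gameApp {μ : Cardinal.{0}} {lam : ℕ → Cardinal.{0}} (hreg : ∀ k, (lam k).IsRegular)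
    (hs : StrictMono lam) (h1 : ∀ k, ℵ_ 1 < lam k) (hμ : ∀ k, lam k < μ) {𝒞 : Set (Set Ordinal.{0})}
    (hC : ClubFam (Iio μ.ord) 𝒞) :
    ∃ γ < (ℵ_ 1).ord, ∃ E : ℕ → Ordinal.{0} → Ordinal.{0}, (∀ n x, x < (lam n).ord → E n x < (lam n).ord) ∧
      ∀ g : ℕ → Ordinal.{0}, (∀ n, g n < (lam n).ord) → ∃ a ∈ 𝒞, a.Infinite ∧ Emb a γ ∧
        ∀ n, g n < chi lam a n ∧ chi lam a n ≤ E n (g n) := by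
  classical
  obtain ⟨hCs, hCc, hCu⟩ := hC
  have h0 : ∀ k, ℵ₀ < lam k := fun k => aleph0_lt_aleph_one.trans (h1 k)
  have hωμ : Iio Ordinal.omega0.{0} ∈ small (Iio μ.ord) := by
    refine ⟨fun x hx => show x < μ.ord from lt_of_lt_of_le (show x < Ordinal.omega0 from hx) ?_, ?_⟩
    · rw [← ord_aleph0]; exact ord_le_ord.mpr ((h0 0).trans (hμ 0)).le
    · rw [← le_aleph0_iff_set_countable, mk_Iio_ordinal, Ordinal.card_omega0]; simp
  have hG : ∀ y : Set Ordinal.{0}, ∃ z ∈ 𝒞, y ∈ small (Iio μ.ord) → y ⊆ z := by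
    intro y
    by_cases h : y ∈ small (Iio μ.ord)
    · obtain ⟨z, hz, h2⟩ := hCu y h; exact ⟨z, hz, fun _ => h2⟩
    · obtain ⟨z, hz, h2⟩ := hCu _ hωμ; exact ⟨z, hz, fun h' => absurd h' h⟩
  choose G hG1 hG2 using hG
  let F : List Ordinal.{0} → Set Ordinal.{0} := fun l => l.foldl (fun y v => G (insert v y)) (G (Iio Ordinal.omega0))
  have hF0 : F [] = G (Iio Ordinal.omega0) := rfl
  have hFs : ∀ l v, F (l ++ [v]) = G (insert v (F l)) := fun l v => by simp [F]
  have hFC : ∀ l, F l ∈ 𝒞 := by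
    intro l
    induction l using List.reverseRecOn with
    | nil => exact hG1 _
    | append_singleton l v _ => rw [hFs]; exact hG1 _
  have hen : ∀ y : Set Ordinal.{0}, ∃ e : ℕ → Ordinal.{0}, y.Countable → y.Nonempty → y = range e := by
    intro y
    by_cases h : y.Countable ∧ y.Nonempty
    · obtain ⟨e, he⟩ := h.1.exists_eq_range h.2; exact ⟨e, fun _ _ => he⟩
    · exact ⟨fun _ => 0, fun h1 h2 => absurd ⟨h1, h2⟩ h⟩
  choose en hen using hen
  let el : (ℕ → Ordinal.{0}) → ℕ → Ordinal.{0} := fun x k => en (F (pre x k.unpair.1)) k.unpair.2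
  -- facts on legal sequences
  have hmono : ∀ x : ℕ → Ordinal.{0}, (∀ n, x n < (lam n).ord) → ∀ n,
      insert (x n) (F (pre x n)) ⊆ F (pre x (n + 1)) := by
    intro x hx n
    rw [pre_succ, hFs]
    refine hG2 _ ⟨?_, ?_⟩
    · exact insert_subset ((hx n).trans (ord_lt_ord.mpr (hμ n))) (hCs (hFC _)).1
    · exact (hCs (hFC _)).2.insert _
  have hF0' : Iio Ordinal.omega0 ⊆ F [] := hG2 _ hωμ
  have hmono' : ∀ x : ℕ → Ordinal.{0}, (∀ n, x n < (lam n).ord) → Monotone fun n => F (pre x n) :=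
    fun x hx => monotone_nat_of_le_succ fun n => (subset_insert _ _).trans (hmono x hx n)
  have hne : ∀ x : ℕ → Ordinal.{0}, (∀ n, x n < (lam n).ord) → ∀ n, (F (pre x n)).Nonempty :=
    fun x hx n => ⟨0, hmono' x hx (Nat.zero_le n) (hF0' (Ordinal.omega0_pos))⟩
  have hrange : ∀ x : ℕ → Ordinal.{0}, (∀ n, x n < (lam n).ord) → range (el x) = ⋃ n, F (pre x n) := by
    intro x hx
    ext t
    simp only [mem_range, mem_iUnion]
    constructor
    · rintro ⟨k, rfl⟩
      refine ⟨k.unpair.1, ?_⟩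
      rw [hen _ (hCs (hFC _)).2 (hne x hx k.unpair.1)]
      exact ⟨k.unpair.2, rfl⟩
    · rintro ⟨n, hn⟩
      rw [hen _ (hCs (hFC _)).2 (hne x hx n)] at hn
      obtain ⟨j, rfl⟩ := hn
      exact ⟨Nat.pair n j, by simp [el]⟩
  have haC : ∀ x : ℕ → Ordinal.{0}, (∀ n, x n < (lam n).ord) → range (el x) ∈ 𝒞 := by
    intro x hx
    rw [hrange x hx, ← sUnion_range]
    refine hCc _ ?_ (range_nonempty _) (hmono' x hx).isChain_range (countable_range _)
    rintro _ ⟨n, rfl⟩; exact hFC _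
  have hainf : ∀ x : ℕ → Ordinal.{0}, (∀ n, x n < (lam n).ord) → (range (el x)).Infinite := by
    intro x hx
    have : (Iio Ordinal.omega0.{0}).Infinite := by
      refine Set.infinite_of_injective_forall_mem (f := fun n : ℕ => (n : Ordinal.{0})) Nat.cast_injective
        (fun n => Ordinal.natCast_lt_omega0 n)
    refine this.mono ?_
    rw [hrange x hx]
    exact hF0'.trans (subset_iUnion (fun n => F (pre x n)) 0)
  have hxa : ∀ x : ℕ → Ordinal.{0}, (∀ n, x n < (lam n).ord) → ∀ n, x n ∈ range (el x) := by
    intro x hx n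
    rw [hrange x hx]
    exact mem_iUnion.mpr ⟨n + 1, hmono x hx n (mem_insert _ _)⟩
  have helc : ∀ (x x' : ℕ → Ordinal.{0}) k, (∀ m ≤ k, x m = x' m) → el x k = el x' k := by
    intro x x' k h
    simp only [el]
    rw [pre_congr (u := x) (v := x') fun m hm => h m (hm.le.trans (Nat.unpair_left_le k))]
  let ex : (ℕ → UU) → ℕ → Ordinal.{0} := fun u n => (u n).1
  let W : Ordinal.{0} → Set (ℕ → UU) := fun γ => {u | (∀ k, (u k).2.2 < γ) ∧
    (∀ k k', el (ex u) k < el (ex u) k' → (u k).2.2 < (u k').2.2) ∧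
    ∀ k n, el (ex u) k < (lam n).ord → el (ex u) k < (u n).2.1}
  have hWcl : ∀ γ u, (∀ n, ∃ w ∈ W γ, pre w n = pre u n) → u ∈ W γ := by
    intro γ u h
    have key : ∀ n, ∃ w ∈ W γ, (∀ m ≤ n, w m = u m) ∧ ∀ m ≤ n, el (ex w) m = el (ex u) m := by
      intro n
      obtain ⟨w, hw, hp⟩ := h (n + 1)
      have h2 : ∀ m ≤ n, w m = u m := fun m hm => pre_inj hp (Nat.lt_succ_of_le hm)
      refine ⟨w, hw, h2, fun m hm => helc _ _ _ fun i hi => ?_⟩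
      simp only [ex]; rw [h2 i (hi.trans hm)]
    refine ⟨fun k => ?_, fun k k' hk => ?_, fun k n hk => ?_⟩
    · obtain ⟨w, hw, h2, h3⟩ := key k
      rw [← h2 k le_rfl]; exact hw.1 k
    · obtain ⟨w, hw, h2, h3⟩ := key (max k k')
      rw [← h2 k (le_max_left _ _), ← h2 k' (le_max_right _ _)]
      rw [← h3 k (le_max_left _ _), ← h3 k' (le_max_right _ _)] at hk
      exact hw.2.1 k k' hk
    · obtain ⟨w, hw, h2, h3⟩ := key (max k n)
      rw [← h3 k (le_max_left _ _)] at hk ⊢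
      rw [← h2 n (le_max_right _ _)]
      exact hw.2.2 k n hk
  have hγ : ∃ γ < (ℵ_ 1).ord, ∀ b : List UU → Ordinal.{0}, (∀ l, b l < (lam l.length).ord) →
      ∃ u ∈ W γ, ∀ n, Leg lam n (u n) ∧ b (pre u n) < (u n).1 := by
    by_contra hc
    push Not at hc
    choose! b hb1 hb2 using hc
    have hcard : ∀ n, #(image2 b (Iio (ℵ_ 1).ord) (Hs lam n)) < lift.{1,0} (lam n) := by
      intro n
      refine (mk_image2_le).trans_lt ?_
      have h2 : ℵ₀ ≤ lift.{1,0} (lam n) := aleph0_le_lift.mpr (h0 n).le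
      rw [mk_Iio_ord]
      exact mul_lt_of_lt h2 (Cardinal.lift_lt.mpr (h1 n)) (mk_Hs h1 hs n)
    have hlenH : ∀ n, ∀ l ∈ Hs lam n, l.length = n := by
      intro n
      induction n with
      | zero => rintro l rfl; rfl
      | succ n ih => 
        rintro _ ⟨⟨l, v⟩, ⟨hl, _⟩, rfl⟩
        simp [ih l hl]
    let x : ℕ → Ordinal.{0} := fun n => ls (image2 b (Iio (ℵ_ 1).ord) (Hs lam n))
    have hx : ∀ n, x n < (lam n).ord := by
      intro n
      refine ls_lt (hreg n) (hcard n) ?_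
      rintro _ ⟨γ, hγ, l, hl, rfl⟩
      have := hb1 γ hγ l
      rwa [hlenH n l hl] at this
    let a := range (el x)
    have ha : a.Countable := countable_range _
    let γ := ls (rk a '' a)
    have hγ : γ < (ℵ_ 1).ord := by
      refine ls_ctbl_lt (ha.image _) isRegular_aleph_one aleph0_lt_aleph_one ?_
      rintro _ ⟨z, hz, rfl⟩; exact rk_lt ha z
    let u : ℕ → UU := fun n => (x n, chi lam a n, rk a (el x n))
    have hleg : ∀ n, Leg lam n (u n) := fun n => ⟨hx n,
      ls_ctbl_lt (ha.mono inter_subset_left) (hreg n) (h0 n) (fun y hy => hy.2), rk_lt ha _⟩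
    have hexu : ex u = x := rfl
    have hsm1 := small_ctbl (ha.image (rk a))
    have huW : u ∈ W γ := by
      refine ⟨fun k => lt_ls ⟨el x k, mem_range_self _, rfl⟩, fun k k' h => ?_, fun k n h => ?_⟩
      · exact rk_strict (mem_range_self _) h
      · have := small_ctbl (ha.mono (inter_subset_left (t := Iio (lam n).ord)))
        exact lt_ls (X := a ∩ Iio (lam n).ord) ⟨mem_range_self k, h⟩
    obtain ⟨n, hn⟩ := hb2 γ hγ u huW
    have hsm := small_of_lt (hcard n).le
    exact absurd (hn (hleg n)) (not_le.mpr (lt_ls ⟨γ, hγ, _, pre_mem_Hs hleg n, rfl⟩))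
  obtain ⟨γ, hγ, hyp⟩ := hγ
  obtain ⟨𝒢, hG0, hGs, hGb⟩ := game (fun n => (lam n).ord) (fun n => (hreg n).ord_pos) (fun u : UU => u.1)
    (Leg lam) (W γ) (hWcl γ) hyp
  have : Nonempty UU := ⟨(0, 0, 0)⟩
  choose! r hr1 hr2 hr3 using hGs
  have hcard : ∀ n β, #((fun l => (r l β).2.1) '' (𝒢 ∩ Hs lam n)) < lift.{1,0} (lam n) := fun n β =>
    mk_image_le.trans_lt ((mk_le_mk_of_subset inter_subset_right).trans_lt (mk_Hs h1 hs n))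
  have hlenH : ∀ n, ∀ l ∈ Hs lam n, l.length = n := by
    intro n
    induction n with
    | zero => rintro l rfl; rfl
    | succ n ih => 
      rintro _ ⟨⟨l, v⟩, ⟨hl, _⟩, rfl⟩
      simp [ih l hl]
  refine ⟨γ, hγ, fun n β => ls ((fun l => (r l β).2.1) '' (𝒢 ∩ Hs lam n)), ?_, ?_⟩
  · intro n β hβ
    refine ls_lt (hreg n) (hcard n β) ?_
    rintro _ ⟨l, hl, rfl⟩
    have h2 := hlenH n l hl.2
    have := (hr1 l hl.1 β (by rw [h2]; exact hβ)).2.1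
    rwa [h2] at this
  · intro g hg
    let ll : ℕ → List UU := fun n => Nat.rec [] (fun n l => l ++ [r l (g n)]) n
    have hll : ∀ n, ll (n + 1) = ll n ++ [r (ll n) (g n)] := fun n => rfl
    let u : ℕ → UU := fun n => r (ll n) (g n)
    have hpre : ∀ n, pre u n = ll n := by
      intro n
      induction n with
      | zero => rfl
      | succ n ih => rw [pre_succ, ih, hll]
    have hlen : ∀ n, (ll n).length = n := fun n => by rw [← hpre, pre_len]
    have hin : ∀ n, ll n ∈ 𝒢 := by
      intro n
      induction n with
      | zero => exact hG0
      | succ n ih => exact hr3 _ ih (g n) (by rw [hlen]; exact hg n)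
    have hleg : ∀ n, Leg lam n (u n) := by
      intro n
      have := hr1 _ (hin n) (g n) (by rw [hlen]; exact hg n)
      rwa [hlen] at this
    have huW : u ∈ W γ := hGb u fun n => by rw [hpre]; exact hin n
    have hx : ∀ n, ex u n < (lam n).ord := fun n => (hleg n).1
    have hsmall : ∀ n, Small.{0} (range (el (ex u)) ∩ Iio (lam n).ord : Set Ordinal.{0}) := fun n =>
      small_ctbl ((countable_range _).mono inter_subset_left)
    refine ⟨range (el (ex u)), haC _ hx, hainf _ hx, ?_, fun n => ⟨?_, ?_⟩⟩
    · have hk : ∀ y, ∃ k, y ∈ range (el (ex u)) → el (ex u) k = y := by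
        intro y
        by_cases h : y ∈ range (el (ex u))
        · obtain ⟨k, hk⟩ := h; exact ⟨k, fun _ => hk⟩
        · exact ⟨0, fun h' => absurd h' h⟩
      choose k hk using hk
      refine ⟨fun y => (u (k y)).2.2, fun y _ => huW.1 _, fun y hy z hz hyz => huW.2.1 _ _ ?_⟩
      rw [hk y hy, hk z hz]; exact hyz
    · have h2 : g n < (u n).1 := hr2 _ (hin n) (g n) (by rw [hlen]; exact hg n)
      exact h2.trans (lt_ls ⟨hxa _ hx n, hx n⟩)
    · have := small_of_lt (hcard n (g n)).le
      refine (ls_le (b := (u n).2.1) ?_).trans (lt_ls ?_).le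
      · rintro _ ⟨⟨k, rfl⟩, h3⟩
        exact huW.2.2 k n h3
      · refine ⟨ll n, ⟨hin n, ?_⟩, rfl⟩
        rw [← hpre]; exact pre_mem_Hs hleg n


end

section
open Order Filter

def Nice (f : Ordinal.{0} → ℕ → Ordinal.{0}) (ρ : Ordinal.{0}) (X : Ordinal.{0} → ℕ → Ordinal.{0}) : Prop :=
  (∀ i j, i ≤ j → j < (ℵ_ 1).ord → ∀ n, X i n ≤ X j n) ∧
  (∀ i < (ℵ_ 1).ord, i ≠ 0 → (∀ j < i, j + 1 < i) → ∀ n, ∀ x < X i n, ∃ j < i, x < X j n) ∧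
  (∀ ξ < ρ, ∃ i < (ℵ_ 1).ord, ∀ᶠ n in atTop, f ξ n < X i n) ∧
  (∀ i < (ℵ_ 1).ord, ∃ ξ < ρ, ∀ᶠ n in atTop, X i n < f ξ n)

lemma nice_le {f ρ X X'} (h : Nice f ρ X) (h' : Nice f ρ X') : ∃ Φ : Ordinal.{0} → Ordinal.{0},
    (∀ x < (ℵ_ 1).ord, Φ x < (ℵ_ 1).ord) ∧ ∀ᶠ n in atTop, ∀ i < (ℵ_ 1).ord, i ≠ 0 → (∀ j < i, j + 1 < i) →
      Cl Φ i → X i n ≤ X' i n := by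
  classical
  have h1 : ∀ᶠ n in atTop, ∀ i < (ℵ_ 1).ord, ∃ j < (ℵ_ 1).ord, X i n ≤ X' j n := by
    by_contra hc
    rw [not_eventually] at hc
    have hI : ∀ n, ∃ i < (ℵ_ 1).ord, (¬ ∀ i < (ℵ_ 1).ord, ∃ j < (ℵ_ 1).ord, X i n ≤ X' j n) →
        ∀ j < (ℵ_ 1).ord, X' j n < X i n := by
      intro n
      by_cases hn : ∀ i < (ℵ_ 1).ord, ∃ j < (ℵ_ 1).ord, X i n ≤ X' j n
      · exact ⟨0, isRegular_aleph_one.ord_pos, fun h => absurd hn h⟩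
      · have hn' := hn
        push Not at hn'
        obtain ⟨i, hi, h3⟩ := hn'
        exact ⟨i, hi, fun _ => h3⟩
    choose I hI1 hI2 using hI
    have hb : ls (range I) < (ℵ_ 1).ord := lsr_lt isRegular_aleph_one (by simp) hI1
    obtain ⟨ξ, hξ, h3⟩ := h.2.2.2 _ hb
    obtain ⟨j, hj, h4⟩ := h'.2.2.1 ξ hξ
    obtain ⟨n, hn, h5, h6⟩ := (hc.and_eventually (h3.and h4)).exists
    have h7 := h.1 (I n) _ (lt_ls (mem_range_self n)).le hb n
    exact absurd (hI2 n hn j hj) (not_lt.mpr (h7.trans (h5.le.trans h6.le)))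
  have hP : ∀ n i, ∃ j < (ℵ_ 1).ord, (∃ j < (ℵ_ 1).ord, X i n ≤ X' j n) → X i n ≤ X' j n := by
    intro n i
    by_cases hn : ∃ j < (ℵ_ 1).ord, X i n ≤ X' j n
    · obtain ⟨j, hj, h3⟩ := hn; exact ⟨j, hj, fun _ => h3⟩
    · exact ⟨0, isRegular_aleph_one.ord_pos, fun h => absurd h hn⟩
  choose P hP1 hP2 using hP
  refine ⟨fun i => ls (range fun n => P n i), fun x _ => 
    lsr_lt isRegular_aleph_one (by simp) fun n => hP1 n x, ?_⟩
  filter_upwards [h1] with n hn i hi hi0 hil hcl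
  by_contra hc
  push Not at hc
  obtain ⟨j, hj, h3⟩ := h.2.1 i hi hi0 hil n _ hc
  have h4 := hP2 n j (hn j (hj.trans hi))
  have h5 : P n j < i := (lt_ls (X := range fun n => P n j) ⟨n, rfl⟩).trans (hcl j hj)
  exact absurd (h3.trans_le (h4.trans (h'.1 _ _ h5.le hi n))) (lt_irrefl _)

lemma nice_unique {f ρ X X'} (h : Nice f ρ X) (h' : Nice f ρ X') : ∃ Φ : Ordinal.{0} → Ordinal.{0},
    (∀ x < (ℵ_ 1).ord, Φ x < (ℵ_ 1).ord) ∧ ∀ i < (ℵ_ 1).ord, i ≠ 0 → Cl Φ i →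
      ∀ᶠ n in atTop, X i n = X' i n := by
  obtain ⟨Φ, h1, h2⟩ := nice_le h h'
  obtain ⟨Ψ, h3, h4⟩ := nice_le h' h
  refine ⟨fun x => max (max (Φ x) (Ψ x)) (x + 1), fun x hx => max_lt (max_lt (h1 x hx) (h3 x hx))
    (succ_lt_reg isRegular_aleph_one.aleph0_le hx), fun i hi hi0 hcl => ?_⟩
  filter_upwards [h2, h4] with n hn hn'
  have hl : ∀ j < i, j + 1 < i := fun j hj => (le_max_right _ _).trans_lt (hcl j hj)
  exact le_antisymm (hn i hi hi0 hl fun j hj => ((le_max_left _ _).trans (le_max_left _ _)).trans_lt (hcl j hj))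
    (hn' i hi hi0 hl fun j hj => ((le_max_right _ _).trans (le_max_left _ _)).trans_lt (hcl j hj))

def AA (μ : Cardinal.{0}) (lam : ℕ → Cardinal.{0}) (f : Ordinal.{0} → ℕ → Ordinal.{0})
    (h : Ordinal.{0} → Ordinal.{0}) (𝒳 : Set (ℕ → Ordinal.{0})) : Set (Set Ordinal.{0}) :=
  {a | a ∈ ctblInf (Iio μ.ord) ∧ ∃ σ < (succ μ).ord, (∀ ξ < σ, ∀ᶠ n in atTop, f ξ n < chi lam a n) ∧
    (∀ᶠ n in atTop, chi lam a n < f σ n) ∧ Emb a (h σ) ∧ ∀ χ ∈ 𝒳, ¬ ∀ᶠ n in atTop, chi lam a n = χ n}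

lemma not_all_emb {A : Set Ordinal.{0}} (hA : #A = ℵ_ 1) {γ : Ordinal.{0}} (hγ : γ < (ℵ_ 1).ord) :
    ∃ c ⊆ A, c.Countable ∧ ¬ Emb c γ := by
  have hγc : (Iio γ).Countable := by
    rw [← le_aleph0_iff_set_countable]
    have := mk_Iio_lt hγ
    rw [← succ_aleph0, Cardinal.lift_succ, lt_succ_iff, lift_aleph0] at this
    exact this
  have hinj : InjOn (rk A) A := by
    intro x hx y hy hxy
    rcases lt_trichotomy x y with h | h | h
    · exact absurd hxy (rk_strict hx h).ne
    · exact h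
    · exact absurd hxy (rk_strict hy h).ne'
  have hex : ∃ y, y ∈ A ∧ γ ≤ rk A y := by
    by_contra hc
    push Not at hc
    have : A.Countable := by
      refine MapsTo.countable_of_injOn (t := Iio γ) (fun y hy => hc y hy) hinj hγc
    rw [← le_aleph0_iff_set_countable, hA] at this
    exact absurd this (not_le.mpr aleph0_lt_aleph_one)
  obtain ⟨y, ⟨hy, hyγ⟩, hmin⟩ := exists_minimal_of_wellFoundedLT _ hex
  refine ⟨A ∩ Iic y, inter_subset_left, ?_, ?_⟩
  · have : (A ∩ Iio y).Countable := by
      refine MapsTo.countable_of_injOn (f := rk A) (t := Iio γ) (fun z hz => ?_) (hinj.mono inter_subset_left) hγc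
      by_contra hc
      exact absurd (hmin ⟨hz.1, not_lt.mp hc⟩ hz.2.le) (not_le.mpr hz.2)
    refine (this.union (countable_singleton y)).mono ?_
    rintro z ⟨hz, hzy⟩
    rcases lt_or_eq_of_le (show z ≤ y from hzy) with h | h
    · exact Or.inl ⟨hz, h⟩
    · exact Or.inr h
  · rintro ⟨φ, h1, h2⟩
    have key : ∀ z, z ∈ A → z ≤ y → rk A z ≤ φ z := by
      intro z
      induction z using WellFoundedLT.induction with
      | ind z ih =>
        intro hz hzy
        rw [rk_eq]
        refine ls_le ?_
        rintro _ ⟨w, hw, rfl⟩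
        have hwz : w < z := hw.2
        exact (ih w hwz hw.1 (hwz.le.trans hzy)).trans_lt (h2 w ⟨hw.1, hwz.le.trans hzy⟩ z ⟨hz, hzy⟩ hwz)
    exact absurd (h1 y ⟨hy, show y ≤ y from le_rfl⟩) (not_lt.mpr (hyγ.trans (key y hy le_rfl)))

lemma Emb.mono {a b : Set Ordinal.{0}} {γ : Ordinal.{0}} (h : Emb b γ) (hab : a ⊆ b) : Emb a γ := by
  obtain ⟨φ, h1, h2⟩ := h
  exact ⟨φ, fun x hx => h1 x (hab hx), fun x hx y hy => h2 x (hab hx) y (hab hy)⟩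

lemma exists_bd {A y : Set Ordinal.{0}} {en : Ordinal.{0} → Ordinal.{0}} (hen : en '' Iio (ℵ_ 1).ord = A)
    (hy : y ⊆ A) (hyc : y.Countable) : ∃ b < (ℵ_ 1).ord, y ⊆ en '' Iio b := by
  have h1 : ∀ x, ∃ i, x ∈ y → i < (ℵ_ 1).ord ∧ en i = x := by
    intro x
    by_cases hx : x ∈ y
    · have := hy hx
      rw [← hen] at this
      obtain ⟨i, hi, h⟩ := this
      exact ⟨i, fun _ => ⟨hi, h⟩⟩
    · exact ⟨0, fun h => absurd h hx⟩
  choose I hI using h1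
  have := small_ctbl (hyc.image I)
  refine ⟨ls (I '' y), ls_ctbl_lt (hyc.image I) isRegular_aleph_one aleph0_lt_aleph_one ?_, ?_⟩
  · rintro _ ⟨x, hx, rfl⟩; exact (hI x hx).1
  · intro x hx
    exact ⟨I x, lt_ls (X := I '' y) ⟨x, hx, rfl⟩, (hI x hx).2⟩

lemma ctbl_Iio {i : Ordinal.{0}} (h : i < (ℵ_ 1).ord) : (Iio i).Countable := by
  rw [← le_aleph0_iff_set_countable]
  have := mk_Iio_lt h
  rw [← succ_aleph0, Cardinal.lift_succ, lt_succ_iff, lift_aleph0] at this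
  exact this

lemma club_idx {A : Set Ordinal.{0}} {en : Ordinal.{0} → Ordinal.{0}} (hen : en '' Iio (ℵ_ 1).ord = A)
    {Φ : Ordinal.{0} → Ordinal.{0}} (hΦ : ∀ x < (ℵ_ 1).ord, Φ x < (ℵ_ 1).ord) :
    ClubFam A {a | ∃ i < (ℵ_ 1).ord, i ≠ 0 ∧ Cl Φ i ∧ a = en '' Iio i} := by
  refine ⟨?_, ?_, ?_⟩
  · rintro _ ⟨i, hi, _, _, rfl⟩
    exact ⟨hen ▸ image_mono (Iio_subset_Iio hi.le), (ctbl_Iio hi).image _⟩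
  · intro D hD hne _ hDc
    have hD' : ∀ d, d ∈ D → ∃ i < (ℵ_ 1).ord, i ≠ 0 ∧ Cl Φ i ∧ d = en '' Iio i := fun d hd => hD hd
    choose! I hI1 hI2 hI3 hI4 using hD'
    have hsm := small_ctbl (hDc.image I)
    have hbd : BddAbove (I '' D) := Ordinal.bddAbove_of_small
    have hne' : (I '' D).Nonempty := hne.image I
    refine ⟨sSup (I '' D), ?_, ?_, ?_, ?_⟩
    · refine lt_of_le_of_lt (csSup_le' (a := ls (I '' D)) fun x hx => (lt_ls hx).le)
        (ls_ctbl_lt (hDc.image I) isRegular_aleph_one aleph0_lt_aleph_one ?_)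
      rintro _ ⟨d, hd, rfl⟩; exact hI1 d hd
    · obtain ⟨d, hd⟩ := hne
      refine (lt_of_lt_of_le (pos_iff_ne_zero.mpr (hI2 d hd)) (le_csSup hbd ⟨d, hd, rfl⟩)).ne'
    · intro x hx
      obtain ⟨_, ⟨d, hd, rfl⟩, hxd⟩ := (lt_csSup_iff hbd hne').mp hx
      exact lt_of_lt_of_le (hI3 d hd x hxd) (le_csSup hbd ⟨d, hd, rfl⟩)
    · ext t
      constructor
      · rintro ⟨d, hd, ht⟩
        rw [hI4 d hd] at ht
        obtain ⟨x, hx, rfl⟩ := ht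
        exact ⟨x, lt_of_lt_of_le (show x < I d from hx) (le_csSup hbd ⟨d, hd, rfl⟩), rfl⟩
      · rintro ⟨x, hx, rfl⟩
        obtain ⟨_, ⟨d, hd, rfl⟩, hxd⟩ := (lt_csSup_iff hbd hne').mp hx
        exact ⟨d, hd, by rw [hI4 d hd]; exact ⟨x, hxd, rfl⟩⟩
  · rintro y ⟨hy, hyc⟩
    obtain ⟨b, hb, hyb⟩ := exists_bd hen hy hyc
    obtain ⟨δ, hδ, hbδ, hcl, _⟩ := exists_cl (Φ := Φ) isRegular_aleph_one hΦ hb isRegular_aleph0 aleph0_lt_aleph_one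
    exact ⟨_, ⟨δ, hδ, (lt_of_le_of_lt (zero_le) hbδ).ne', hcl, rfl⟩, hyb.trans (image_mono (Iio_subset_Iio hbδ.le))⟩

lemma chi_mono {lam : ℕ → Cardinal.{0}} {a b : Set Ordinal.{0}} (h : a ⊆ b) (n : ℕ) : chi lam a n ≤ chi lam b n := by
  have : Small.{0} (b ∩ Iio (lam n).ord : Set Ordinal.{0}) := small_subset inter_subset_right
  exact ls_le fun x hx => lt_ls ⟨h hx.1, hx.2⟩

lemma no_reflect {μ : Cardinal.{0}} (hμ : ℵ_ 1 < μ) {lam : ℕ → Cardinal.{0}} {f : Ordinal.{0} → ℕ → Ordinal.{0}}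
    {h : Ordinal.{0} → Ordinal.{0}} {𝒳 : Set (ℕ → Ordinal.{0})} {Xc : Ordinal.{0} → Ordinal.{0} → ℕ → Ordinal.{0}}
    (hh : ∀ σ, h σ < (ℵ_ 1).ord)
    (hXc : ∀ ρ, (∃ X, Nice f ρ X) → Nice f ρ (Xc ρ))
    (h𝒳 : ∀ ρ < (succ μ).ord, ∀ i < (ℵ_ 1).ord, Xc ρ i ∈ 𝒳)
    {A : Set Ordinal.{0}} (hA : #A = ℵ_ 1) : ¬ Reflects (AA μ lam f h 𝒳) A := by
  classical
  intro hR
  have hΛ : (succ μ).IsRegular := isRegular_succ (aleph0_lt_aleph_one.trans hμ).le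
  have hen : ∃ en : Ordinal.{0} → Ordinal.{0}, en '' Iio (ℵ_ 1).ord = A := by
    have : #(Iio (ℵ_ 1).ord) = #A := by rw [mk_Iio_ord, hA]; simp
    obtain ⟨e⟩ := Cardinal.eq.mp this
    refine ⟨fun i => if hi : i < (ℵ_ 1).ord then e ⟨i, hi⟩ else 0, ?_⟩
    ext t
    constructor
    · rintro ⟨i, hi, rfl⟩
      have hi' : i < (ℵ_ 1).ord := hi
      simp only [hi', dif_pos]; exact (e _).2
    · intro ht
      refine ⟨e.symm ⟨t, ht⟩, (e.symm ⟨t, ht⟩).2, ?_⟩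
      have hi' : (e.symm ⟨t, ht⟩ : Ordinal.{0}) < (ℵ_ 1).ord := (e.symm ⟨t, ht⟩).2
      simp only [hi', dif_pos]
      exact congrArg Subtype.val (e.apply_symm_apply ⟨t, ht⟩)
  obtain ⟨en, hen⟩ := hen
  let a : Ordinal.{0} → Set Ordinal.{0} := fun i => en '' Iio i
  have hamono : ∀ i j, i ≤ j → a i ⊆ a j := fun i j hij => image_mono (Iio_subset_Iio hij)
  have hT : ∀ Φ : Ordinal.{0} → Ordinal.{0}, (∀ x < (ℵ_ 1).ord, Φ x < (ℵ_ 1).ord) →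
      ∃ i < (ℵ_ 1).ord, i ≠ 0 ∧ Cl Φ i ∧ a i ∈ AA μ lam f h 𝒳 := by
    intro Φ hΦ
    obtain ⟨_, ⟨h1, _⟩, ⟨i, hi, hi0, hcl, rfl⟩⟩ := hR.2 _ (club_idx hen hΦ)
    exact ⟨i, hi, hi0, hcl, h1⟩
  have hTu : ∀ b < (ℵ_ 1).ord, ∃ i < (ℵ_ 1).ord, b < i ∧ a i ∈ AA μ lam f h 𝒳 := by
    intro b hb
    obtain ⟨i, hi, hi0, hcl, h1⟩ := hT (fun _ => b) (fun _ _ => hb)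
    exact ⟨i, hi, hcl 0 (pos_iff_ne_zero.mpr hi0), h1⟩
  have hσ : ∀ i, ∃ σ, a i ∈ AA μ lam f h 𝒳 → σ < (succ μ).ord ∧ (∀ ξ < σ, ∀ᶠ n in atTop, f ξ n < chi lam (a i) n) ∧
    (∀ᶠ n in atTop, chi lam (a i) n < f σ n) ∧ Emb (a i) (h σ) := by
    intro i
    by_cases hi : a i ∈ AA μ lam f h 𝒳
    · obtain ⟨_, σ, h1, h2, h3, h4, _⟩ := id hi
      exact ⟨σ, fun _ => ⟨h1, h2, h3, h4⟩⟩
    · exact ⟨0, fun h => absurd h hi⟩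
  choose σ hσ using hσ
  have hmono : ∀ i j, i ≤ j → a i ∈ AA μ lam f h 𝒳 → a j ∈ AA μ lam f h 𝒳 → σ i ≤ σ j := by
    intro i j hij hi hj
    by_contra hc
    push Not at hc
    obtain ⟨n, h1, h2⟩ := (((hσ i hi).2.1 _ hc).and (hσ j hj).2.2.1).exists
    exact absurd (h1.trans_le ((chi_mono (hamono i j hij) n).trans h2.le)) (lt_irrefl _)
  have hnomax : ∀ i < (ℵ_ 1).ord, a i ∈ AA μ lam f h 𝒳 → ∃ j < (ℵ_ 1).ord, a j ∈ AA μ lam f h 𝒳 ∧ σ i < σ j := by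
    intro i hi hiA
    by_contra hc
    push Not at hc
    obtain ⟨c, hcA, hcc, hce⟩ := not_all_emb hA (hh (σ i))
    obtain ⟨b, hb, hcb⟩ := exists_bd hen hcA hcc
    obtain ⟨j, hj, hbj, hjA⟩ := hTu (max b i) (max_lt hb hi)
    have h1 : σ j = σ i := le_antisymm (hc j hj hjA) (hmono i j ((le_max_right _ _).trans hbj.le) hiA hjA)
    have h2 := (hσ j hjA).2.2.2
    rw [h1] at h2
    exact hce (h2.mono (hcb.trans (hamono b j ((le_max_left _ _).trans hbj.le))))
  let TT : Set Ordinal.{0} := {i | i < (ℵ_ 1).ord ∧ a i ∈ AA μ lam f h 𝒳}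
  have hTTs : #(σ '' TT) < lift.{1,0} (succ μ) := by
    refine mk_image_le.trans_lt ((mk_le_mk_of_subset (t := Iio (ℵ_ 1).ord) fun i hi => hi.1).trans_lt ?_)
    rw [mk_Iio_ord, Cardinal.lift_lt]; exact hμ.trans (lt_succ μ)
  have hρ : ls (σ '' TT) < (succ μ).ord := by
    refine ls_lt hΛ hTTs ?_
    rintro _ ⟨i, hi, rfl⟩; exact (hσ i hi.2).1
  have := small_of_lt hTTs.le
  have hN : Nice f (ls (σ '' TT)) (fun i => chi lam (a i)) := by
    refine ⟨fun i j hij _ n => chi_mono (hamono i j hij) n, ?_, ?_, ?_⟩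
    · intro i hi hi0 hil n x hx
      obtain ⟨y, ⟨⟨t, ht, rfl⟩, hy2⟩, hxy⟩ := exists_of_lt_ls hx
      refine ⟨t + 1, hil t ht, ?_⟩
      have : Small.{0} (a (t + 1) ∩ Iio (lam n).ord : Set Ordinal.{0}) := small_subset inter_subset_right
      exact lt_of_le_of_lt hxy (lt_ls (X := a (t + 1) ∩ Iio (lam n).ord) ⟨⟨t, lt_add_one t, rfl⟩, hy2⟩)
    · intro ξ hξ
      obtain ⟨_, ⟨i, hi, rfl⟩, hξi⟩ := exists_of_lt_ls hξ
      obtain ⟨j, hj, hjA, hlt⟩ := hnomax i hi.1 hi.2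
      exact ⟨j, hj, (hσ j hjA).2.1 ξ (hξi.trans_lt hlt)⟩
    · intro i hi
      obtain ⟨j, hj, hij, hjA⟩ := hTu i hi
      refine ⟨σ j, lt_ls ⟨j, ⟨hj, hjA⟩, rfl⟩, ?_⟩
      filter_upwards [(hσ j hjA).2.2.1] with n hn
      exact (chi_mono (hamono i j hij.le) n).trans_lt hn
  obtain ⟨Φ, hΦ, hu⟩ := nice_unique hN (hXc _ ⟨_, hN⟩)
  obtain ⟨i, hi, hi0, hcl, hiA⟩ := hT Φ hΦ
  obtain ⟨_, _, _, _, _, _, hno⟩ := hiA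
  exact hno _ (h𝒳 _ hρ i hi) (hu i hi hi0 hcl)


end

section
open Order Filter

lemma diag {P : ℕ → ℕ → Prop} (h : ∀ k, ∀ᶠ n in atTop, P k n) :
    ∃ K : ℕ → ℕ, Tendsto K atTop atTop ∧ ∀ᶠ n in atTop, P (K n) n := by
  simp only [eventually_atTop] at h
  choose N hN using h
  refine ⟨fun n => Nat.findGreatest (fun k => N k ≤ n) n, ?_, ?_⟩
  · rw [tendsto_atTop]
    intro b
    filter_upwards [eventually_ge_atTop (max b (N b))] with n hn
    exact Nat.le_findGreatest ((le_max_left _ _).trans hn) ((le_max_right _ _).trans hn)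
  · filter_upwards [eventually_ge_atTop (N 0)] with n hn
    exact hN _ _ (Nat.findGreatest_spec (P := fun k => N k ≤ n) (Nat.zero_le n) hn)

lemma refl_main {μ : Cardinal.{0}} {lam : ℕ → Cardinal.{0}} {f : Ordinal.{0} → ℕ → Ordinal.{0}}
    (hrefl : ∀ 𝒜 : Set (Set Ordinal.{0}), 𝒜 ⊆ ctblInf (Set.Iio μ.ord) →
        StatFam (Set.Iio μ.ord) 𝒜 →
        ∃ A : Set Ordinal.{0}, A ⊆ Set.Iio μ.ord ∧
          #A = Cardinal.aleph 1 ∧ Reflects 𝒜 A)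
    (hreg : ∀ k, (lam k).IsRegular) (hs : StrictMono lam) (h1 : ∀ k, ℵ_ 1 < lam k) (hμ : ∀ k, lam k < μ)
    (hf : ∀ ξ k, f ξ k < (lam k).ord)
    (hfm : ∀ ξ ξ', ξ ≤ ξ' → ξ' < (succ μ).ord → ∀ᶠ k in atTop, f ξ k ≤ f ξ' k)
    (hfc : ∀ g : ℕ → Ordinal.{0}, (∀ k, g k < (lam k).ord) → ∃ σ < (succ μ).ord, ∀ᶠ k in atTop, g k < f σ k)
    {Ln : ℕ → Ordinal.{0}} (hL : ∀ n, Ln n < (lam n).ord) :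
    ∃ 𝒴 : Set (ℕ → Ordinal.{0}), #𝒴 ≤ lift.{1,0} (succ μ) ∧
      ∀ y : ℕ → Ordinal.{0}, (∀ n, y n < Ln n) → ∃ y' ∈ 𝒴, ∀ᶠ n in atTop, y n = y' n := by
  classical
  have hμ1 : ℵ_ 1 < μ := (h1 0).trans (hμ 0)
  have hμ0 : ℵ₀ ≤ μ := (aleph0_lt_aleph_one.trans hμ1).le
  have hΛ : (succ μ).IsRegular := isRegular_succ hμ0
  obtain ⟨h, hh, hsol⟩ := solovay hΛ (hμ1.trans (lt_succ μ))
  have hXc : ∀ ρ, ∃ X, (∃ X, Nice f ρ X) → Nice f ρ X := by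
    intro ρ
    by_cases hX : ∃ X, Nice f ρ X
    · obtain ⟨X, hX⟩ := hX; exact ⟨X, fun _ => hX⟩
    · exact ⟨fun _ _ => 0, fun h => absurd h hX⟩
  choose Xc hXc using hXc
  let 𝒳 : Set (ℕ → Ordinal.{0}) := image2 Xc (Iio (succ μ).ord) (Iio (ℵ_ 1).ord)
  have h𝒳c : #𝒳 ≤ lift.{1,0} (succ μ) := by
    refine mk_image2_le.trans ?_
    have h2 : ℵ₀ ≤ lift.{1,0} (succ μ) := aleph0_le_lift.mpr hΛ.aleph0_le
    rw [mk_Iio_ord, mk_Iio_ord]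
    refine (mul_le_mul' le_rfl (Cardinal.lift_le.mpr (hμ1.le.trans (le_succ μ)))).trans ?_
    rw [mul_eq_self h2]
  have hsub : AA μ lam f h 𝒳 ⊆ ctblInf (Iio μ.ord) := fun a ha => ha.1
  have hnm : ¬ MeetsClubs (Iio μ.ord) (AA μ lam f h 𝒳) := by
    intro hm
    obtain ⟨A, _, hA, hR⟩ := hrefl _ hsub ⟨fun a ha => ⟨(hsub ha).1, (hsub ha).2.1⟩, hm⟩
    exact no_reflect (𝒳 := 𝒳) hμ1 hh hXc (fun ρ hρ i hi => mem_image2_of_mem hρ hi) hA hR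
  unfold MeetsClubs at hnm
  push Not at hnm
  obtain ⟨𝒞, hC, hCe⟩ := hnm
  obtain ⟨γ, hγ, E, hE1, hE2⟩ := gameApp hreg hs h1 hμ hC
  let q : ℕ → Ordinal.{0} → Ordinal.{0} → Ordinal.{0} := fun n p η => itr (fun x => E n x + 1) p η
  have hqlt : ∀ n p η, p < (lam n).ord → η < (lam n).ord → q n p η < (lam n).ord := fun n p η hp hη =>
    itr_lt (hreg n) hp (fun x hx => succ_lt_reg (hreg n).aleph0_le (hE1 n x hx)) hη
  have hqs : ∀ n p η η', η < η' → E n (q n p η) < q n p η' := fun n p η η' hη =>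
    lt_of_lt_of_le (lt_add_one _) (itr_step (Φ := fun x => E n x + 1) hη)
  have hqb : ∀ n p η, p ≤ q n p η := fun n p η => itr_base
  have hΦ : ∀ ξ, ∃ σ < (succ μ).ord, ∀ᶠ n in atTop, q n (f ξ n) (Ln n) < f σ n := fun ξ =>
    hfc _ fun n => hqlt n _ _ (hf ξ n) (hL n)
  choose Φ hΦ1 hΦ2 using hΦ
  obtain ⟨σ, hσ, hcof, hcl, hγσ⟩ := hsol γ hγ Φ (fun x _ => hΦ1 x)
  obtain ⟨t, htm, htσ, htc⟩ := exists_seqω hcof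
  obtain ⟨K, hK, hKP⟩ := diag (P := fun k n => (∀ j ∈ Finset.range (k + 1), f (t j) n ≤ f (t k) n) ∧
      q n (f (t k) n) (Ln n) < f σ n) (by
    intro k
    refine Eventually.and ?_ ?_
    · rw [Filter.eventually_all_finset]
      intro j hj
      exact hfm _ _ (htm.monotone (by simpa [Nat.lt_succ_iff] using hj)) ((htσ k).trans hσ)
    · filter_upwards [hΦ2 (t k), hfm (Φ (t k)) σ (hcl _ (htσ k)).le hσ] with n h2 h3
      exact h2.trans_le h3)
  let p : ℕ → Ordinal.{0} := fun n => f (t (K n)) n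
  have hp1 : ∀ ξ < σ, ∀ᶠ n in atTop, f ξ n ≤ p n := by
    intro ξ hξ
    obtain ⟨j, hj⟩ := htc ξ hξ
    filter_upwards [hfm ξ (t j) hj ((htσ j).trans hσ), hKP, hK.eventually_ge_atTop j] with n h2 h3 h4
    exact h2.trans (h3.1 j (by simpa [Nat.lt_succ_iff] using h4))
  have hp2 : ∀ᶠ n in atTop, q n (p n) (Ln n) < f σ n := by
    filter_upwards [hKP] with n hn using hn.2
  have hp3 : ∀ n, p n < (lam n).ord := fun n => hf _ n
  have hdec : ∀ n v, ∃ η, (∃ η, q n (p n) η < v ∧ v ≤ E n (q n (p n) η)) →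
      q n (p n) η < v ∧ v ≤ E n (q n (p n) η) := by
    intro n v
    by_cases hX : ∃ η, q n (p n) η < v ∧ v ≤ E n (q n (p n) η)
    · obtain ⟨X, hX⟩ := hX; exact ⟨X, fun _ => hX⟩
    · exact ⟨0, fun h => absurd h hX⟩
  choose dec hdec using hdec
  refine ⟨(fun χ n => dec n (χ n)) '' 𝒳, mk_image_le.trans h𝒳c, fun y hy => ?_⟩
  have hg : ∀ n, q n (p n) (y n) < (lam n).ord := fun n => hqlt n _ _ (hp3 n) ((hy n).trans (hL n))
  obtain ⟨a, haC, hainf, haE, hag⟩ := hE2 (fun n => q n (p n) (y n)) hg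
  have haA : a ∉ AA μ lam f h 𝒳 := fun ha => by
    have : a ∈ AA μ lam f h 𝒳 ∩ 𝒞 := ⟨ha, haC⟩
    rw [hCe] at this; exact this
  have : ∃ χ ∈ 𝒳, ∀ᶠ n in atTop, chi lam a n = χ n := by
    by_contra hc
    push Not at hc
    refine haA ⟨⟨(hC.1 haC).1, (hC.1 haC).2, hainf⟩, σ, hσ, ?_, ?_, ?_, ?_⟩
    · intro ξ hξ
      filter_upwards [hp1 ξ hξ] with n hn
      exact (hn.trans (hqb n _ _)).trans_lt (hag n).1
    · filter_upwards [hp2] with n hn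
      exact ((hag n).2.trans_lt (hqs n _ _ _ (hy n))).trans hn
    · obtain ⟨φ, h2, h3⟩ := haE
      exact ⟨φ, fun x hx => (h2 x hx).trans_le hγσ, h3⟩
    · intro χ hχ h2
      obtain ⟨n, hn, hn'⟩ := ((hc χ hχ).and_eventually h2).exists
      exact hn hn'
  obtain ⟨χ, hχ, hχ2⟩ := this
  refine ⟨_, ⟨χ, hχ, rfl⟩, ?_⟩
  filter_upwards [hχ2] with n hn
  have h2 := hag n
  rw [hn] at h2
  have h3 := hdec n (χ n) ⟨y n, h2⟩
  rcases lt_trichotomy (y n) (dec n (χ n)) with h4 | h4 | h4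
  · exact absurd (h2.2.trans_lt ((hqs n (p n) _ _ h4).trans h3.1)) (lt_irrefl _)
  · exact h4
  · exact absurd (h3.2.trans_lt ((hqs n (p n) _ _ h4).trans h2.1)) (lt_irrefl _)


end

section
open Order Filter

lemma cov_le {c κ ρ : Cardinal.{0}} (h : c ≤ κ) (hρ : 0 < ρ) : Cov c κ ρ := by
  refine ⟨fun _ => Iio c.ord, fun _ => ?_, fun X hX _ => ⟨0, ?_, hX⟩⟩
  · rw [mk_Iio_ord, Cardinal.lift_le]; exact h
  · rw [lt_ord]; simpa using hρ

lemma Cov.mono {μ κ ρ ρ' : Cardinal.{0}} (h : Cov μ κ ρ) (hρ : ρ ≤ ρ') : Cov μ κ ρ' := by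
  obtain ⟨P, h1, h2⟩ := h
  refine ⟨P, h1, fun X hX hX' => ?_⟩
  obtain ⟨ζ, hζ, h3⟩ := h2 X hX hX'
  exact ⟨ζ, hζ.trans_le (ord_le_ord.mpr hρ), h3⟩

lemma cov_omega {μ κ : Cardinal.{0}}
    (hrefl : ∀ 𝒜 : Set (Set Ordinal.{0}), 𝒜 ⊆ ctblInf (Set.Iio μ.ord) →
        StatFam (Set.Iio μ.ord) 𝒜 →
        ∃ A : Set Ordinal.{0}, A ⊆ Set.Iio μ.ord ∧
          #A = Cardinal.aleph 1 ∧ Reflects 𝒜 A)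
    (hκ : ℵ₀ ≤ κ) (hκμ : κ < μ) (hlim : ∀ k < μ, succ k < μ) (hcof : μ.ord.cof = ℵ₀)
    (IH : ∀ c < μ, Cov c κ (succ c)) : Cov μ κ (succ μ) := by
  obtain ⟨lam, f, hreg, hs, h1, hlμ, hlc, hf, hfm, hfc⟩ := exists_scale (hκ.trans_lt hκμ) hcof hlim
  let c : ℕ → Cardinal.{0} := fun m => if m < 2 then ℵ₀ else lam (m - 2)
  have hc : ∀ m, succ (c m) < lam m := by
    intro m
    by_cases hm : m < 2
    · simp only [c, hm, if_true, succ_aleph0]; exact h1 m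
    · simp only [c, hm, if_false]
      exact lt_of_le_of_lt (succ_le_of_lt (hs (show m - 2 < m - 1 by omega))) (hs (by omega))
  obtain ⟨𝒴, h𝒴, hy⟩ := refl_main hrefl hreg hs h1 hlμ hf hfm hfc (Ln := fun m => (succ (c m)).ord)
    (fun m => ord_lt_ord.mpr (hc m))
  have hP := fun m => IH (c m) ((lt_succ _).trans ((hc m).trans (hlμ m)))
  choose P hP1 hP2 using hP
  refine cov_of_index (I := 𝒴) h𝒴 (fun y => ⋃ i ∈ (univ : Set (ULift.{1} ℕ)), P i.down (y.1 i.down)) ?_ ?_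
  · intro y
    refine mk_bUnion_le' hκ ?_ fun i _ => hP1 _ _
    simpa using hκ
  · intro X hX hXκ
    have := fun m => hP2 m (X ∩ Iio (c m).ord) inter_subset_right ((mk_le_mk_of_subset inter_subset_left).trans hXκ)
    choose ζ hζ1 hζ2 using this
    obtain ⟨y', hy', he⟩ := hy ζ hζ1
    refine ⟨⟨y', hy'⟩, fun x hx => ?_⟩
    obtain ⟨k, hk⟩ := hlc x.card (lt_ord.mp (hX hx))
    obtain ⟨m, hm1, hm2⟩ := (he.and (eventually_ge_atTop (k + 2))).exists
    have h3 : x < (c m).ord := by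
      rw [lt_ord]
      simp only [c, show ¬ m < 2 by omega, if_false]
      exact hk.trans_le (hs.monotone (by omega))
    simp only [mem_iUnion]
    refine ⟨⟨m⟩, mem_univ _, ?_⟩
    have := hζ2 m ⟨hx, h3⟩
    rwa [hm1] at this

lemma cov_reg {μ κ : Cardinal.{0}} (hκ : ℵ₀ ≤ κ) (hcof : κ < μ.ord.cof)
    (IH : ∀ c < μ, Cov c κ (succ c)) : Cov μ κ μ := by
  have hκμ : κ < μ := hcof.trans_le (by simpa using Ordinal.cof_le_card μ.ord)
  have hP : ∀ α, ∃ P : Ordinal.{0} → Set Ordinal.{0}, (∀ ζ, #(P ζ) ≤ lift.{1,0} κ) ∧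
    (α < μ.ord → ∀ X : Set Ordinal.{0}, X ⊆ Iio α → #X ≤ lift.{1,0} κ → ∃ ζ < μ.ord, X ⊆ P ζ) := by
    intro α
    by_cases hα : α < μ.ord
    · have hα' : α.card < μ := lt_ord.mp hα
      obtain ⟨P, h1, h2⟩ := IH _ hα'
      obtain ⟨g, hg1, hg2⟩ := exists_inj (c := α.card) (ζ := α) (lt_ord.mpr (lt_succ _))
      refine ⟨fun ζ => {x | x < α ∧ g x ∈ P ζ}, fun ζ => ?_, fun _ X hX hX' => ?_⟩
      · refine le_trans ?_ (h1 ζ)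
        refine mk_le_of_injective (f := fun z : {x | x < α ∧ g x ∈ P ζ} => (⟨g z, z.2.2⟩ : P ζ)) ?_
        rintro ⟨x, hx⟩ ⟨y, hy⟩ hxy
        simp only [Subtype.mk.injEq]
        exact hg2 x hx.1 y hy.1 (congrArg Subtype.val hxy)
      · obtain ⟨ζ, hζ, h3⟩ := h2 (g '' X) (by rintro _ ⟨x, hx, rfl⟩; exact hg1 x (hX hx)) (mk_image_le.trans hX')
        exact ⟨ζ, hζ.trans_le (ord_le_ord.mpr (succ_le_of_lt hα')), fun x hx => ⟨hX hx, h3 ⟨x, hx, rfl⟩⟩⟩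
    · exact ⟨fun _ => ∅, by simp, fun h => absurd h hα⟩
  choose P hP1 hP2 using hP
  refine cov_of_index (I := Iio μ.ord × Iio μ.ord) ?_ (fun t => P t.1 t.2) (fun t => hP1 _ _) ?_
  · have h2 : ℵ₀ ≤ lift.{1,0} μ := aleph0_le_lift.mpr (hκ.trans hκμ.le)
    simp only [mk_prod, Cardinal.lift_id, mk_Iio_ord]
    rw [mul_eq_self h2]
  · intro X hX hXκ
    have h3 : ls X < μ.ord := ls_lt_cof (hXκ.trans_lt (Cardinal.lift_lt.mpr hcof)) hX
    have := small_of_lt hXκ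
    obtain ⟨ζ, hζ, h4⟩ := hP2 _ h3 X (fun x hx => lt_ls hx) hXκ
    exact ⟨⟨⟨_, h3⟩, ⟨ζ, hζ⟩⟩, h4⟩

lemma cov_main 
    (hrefl : ∀ lam : Cardinal.{0}, Cardinal.aleph 1 < lam →
      ∀ 𝒜 : Set (Set Ordinal.{0}), 𝒜 ⊆ ctblInf (Set.Iio lam.ord) →
        StatFam (Set.Iio lam.ord) 𝒜 →
        ∃ A : Set Ordinal.{0}, A ⊆ Set.Iio lam.ord ∧
          #A = Cardinal.aleph 1 ∧ Reflects 𝒜 A) {κ : Cardinal.{0}} (hκ : ℵ₀ ≤ κ) (μ : Cardinal.{0}) :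
    Cov μ κ (succ μ) ∧ (κ < μ.ord.cof → Cov μ κ μ) := by
  induction μ using WellFoundedLT.induction with
  | ind μ ih =>
    have IH : ∀ c < μ, Cov c κ (succ c) := fun c hc => (ih c hc).1
    refine ⟨?_, fun h => cov_reg hκ h IH⟩
    rcases le_or_gt μ κ with h | hκμ
    · exact cov_le h (succ_pos μ)
    rcases lt_or_ge κ μ.ord.cof with h | h
    · exact (cov_reg hκ h IH).mono (le_succ μ)
    have hμ := hκ.trans hκμ.le
    have hlim : ∀ k < μ, succ k < μ := by
      intro k hk
      refine lt_of_le_of_ne (succ_le_of_lt hk) fun he => ?_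
      have hk' : κ ≤ k := lt_succ_iff.mp (he ▸ hκμ)
      have := isRegular_succ (hκ.trans hk')
      rw [he] at this
      rw [this.cof_ord] at h
      exact absurd hκμ (not_lt.mpr h)
    have hcof : ℵ₀ ≤ μ.ord.cof := (isRegular_cof (isSuccLimit_ord hμ)).aleph0_le
    rcases eq_or_lt_of_le hcof with h2 | h2
    · refine cov_omega (hrefl μ ?_) hκ hκμ hlim h2.symm IH
      have h3 := hlim _ (hlim _ (hκ.trans_lt hκμ))
      rw [succ_aleph0] at h3
      exact (lt_succ _).trans h3
    · exact silver hκ hκμ hlim h2 h fun c hc _ => IH c hc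

lemma covCf_le {μ κ ρ : Cardinal.{0}} (h : Cov μ κ ρ) : covCf μ κ ≤ lift.{1,0} ρ := by
  obtain ⟨P, h1, h2⟩ := h
  have h0 : #((fun ζ => P ζ ∩ Iio μ.ord) '' Iio ρ.ord) ≤ lift.{1,0} ρ := mk_image_le.trans (mk_Iio_ord ρ).le
  refine le_trans ?_ h0
  unfold covCf
  apply csInf_le'
  refine ⟨(fun ζ => P ζ ∩ Iio μ.ord) '' Iio ρ.ord, ?_, rfl, ?_⟩
  · rintro _ ⟨ζ, _, rfl⟩
    exact ⟨inter_subset_right, (mk_le_mk_of_subset inter_subset_left).trans (h1 ζ)⟩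
  · intro b hb hb'
    obtain ⟨ζ, hζ, h3⟩ := h2 b hb hb'
    exact ⟨_, ⟨ζ, hζ, rfl⟩, subset_inter h3 hb⟩

lemma le_covCf {μ κ : Cardinal.{0}} {c : Cardinal.{1}} (h : ∀ F : Set (Set Ordinal.{0}),
    (∀ a ∈ F, a ⊆ Set.Iio μ.ord ∧ #a ≤ Cardinal.lift.{1,0} κ) → 
    (∀ b : Set Ordinal.{0}, b ⊆ Set.Iio μ.ord → #b ≤ Cardinal.lift.{1,0} κ →
      ∃ a ∈ F, b ⊆ a) → c ≤ #F) : c ≤ covCf μ κ := by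
  refine le_csInf ⟨_, {a | a ⊆ Iio μ.ord ∧ #a ≤ lift.{1,0} κ}, fun a ha => ha, rfl,
    fun b hb hb' => ⟨b, ⟨hb, hb'⟩, Subset.rfl⟩⟩ ?_
  rintro _ ⟨F, h1, rfl, h2⟩
  exact h F h1 h2

lemma low1 {μ κ : Cardinal.{0}} (hκ : ℵ₀ ≤ κ) (hκμ : κ < μ) : lift.{1,0} μ ≤ covCf μ κ := by
  refine le_covCf fun F h1 h2 => ?_
  by_contra hc
  push Not at hc
  have h3 : ℵ₀ ≤ lift.{1,0} μ := aleph0_le_lift.mpr (hκ.trans hκμ.le)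
  have h4 : #(⋃₀ F) < lift.{1,0} μ := by
    refine (mk_sUnion_le F).trans_lt (mul_lt_of_lt h3 hc ?_)
    exact lt_of_le_of_lt (ciSup_le' fun s : F => (h1 s s.2).2) (Cardinal.lift_lt.mpr hκμ)
  rw [← mk_Iio_ord] at h4
  refine absurd (mk_le_mk_of_subset fun x hx => ?_) (not_le.mpr h4)
  obtain ⟨a, ha, hxa⟩ := h2 {x} (singleton_subset_iff.mpr hx) (by
    rw [mk_singleton]
    exact one_lt_aleph0.le.trans (aleph0_le_lift.mpr hκ))
  exact ⟨a, ha, hxa rfl⟩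

lemma not_cov {μ κ : Cardinal.{0}} (hκ : ℵ₀ ≤ κ) (hκμ : κ < μ) (hcof : μ.ord.cof ≤ κ) : ¬ Cov μ κ μ := by
  rintro ⟨P, h1, h2⟩
  have hμ := hκ.trans hκμ.le
  have h3 : ℵ₀ ≤ lift.{1,0} μ := aleph0_le_lift.mpr hμ
  obtain ⟨e, he1, he2, he3⟩ := exists_cof_seq μ.ord
  have hb : ∀ i < μ.ord.cof.ord, ∃ b < μ.ord, b ∉ ⋃ ξ ∈ Iio (e i), P ξ := by
    intro i hi
    by_contra hc
    push Not at hc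
    have h4 : #(⋃ ξ ∈ Iio (e i), P ξ) < lift.{1,0} μ := by
      refine (mk_biUnion_le P _).trans_lt (mul_lt_of_lt h3 (mk_Iio_lt (he1 i hi)) ?_)
      exact lt_of_le_of_lt (ciSup_le' fun s => h1 _) (Cardinal.lift_lt.mpr hκμ)
    rw [← mk_Iio_ord] at h4
    exact absurd (mk_le_mk_of_subset fun x hx => hc x hx) (not_le.mpr h4)
  choose! b hb1 hb2 using hb
  obtain ⟨ζ, hζ, h5⟩ := h2 (b '' Iio μ.ord.cof.ord) (by rintro _ ⟨i, hi, rfl⟩; exact hb1 i hi)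
    (mk_image_le.trans (by rw [mk_Iio_ord, Cardinal.lift_le]; exact hcof))
  obtain ⟨i, hi, h6⟩ := he3 (ζ + 1) (succ_lt_reg hμ hζ)
  refine hb2 i hi (mem_iUnion₂.mpr ⟨ζ, lt_of_lt_of_le (lt_add_one ζ) h6, h5 ⟨i, hi, rfl⟩⟩)

lemma low2 {μ κ : Cardinal.{0}} (hκ : ℵ₀ ≤ κ) (hκμ : κ < μ) (hcof : μ.ord.cof ≤ κ) :
    lift.{1,0} (succ μ) ≤ covCf μ κ := by
  refine le_covCf fun F h1 h2 => ?_
  by_contra hc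
  push Not at hc
  rw [Cardinal.lift_succ, lt_succ_iff] at hc
  refine not_cov hκ hκμ hcof (cov_of_index (I := F) hc (fun a => a.1) (fun a => (h1 a a.2).2) fun X hX hX' => ?_)
  obtain ⟨a, ha, h⟩ := h2 X hX hX'
  exact ⟨⟨a, ha⟩, h⟩


end

/-- if for every cardinal `λ > ℵ₁` every stationary `𝒜 ⊆ [λ]^{ℵ₀}`
reflects in some `A ⊆ λ` of cardinality `ℵ₁`, then for every singular `μ` and infinite
`κ < μ`: `cf([μ]^{≤κ},⊆) = μ` if `κ < cf(μ)`, and `cf([μ]^{≤κ},⊆) = μ⁺` if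
`cf(μ) ≤ κ`; in particular `cf([μ]^{≤cf(μ)},⊆) = μ⁺` for every singular `μ`. -/
theorem stmt5
    (hrefl : ∀ lam : Cardinal.{0}, Cardinal.aleph 1 < lam →
      ∀ 𝒜 : Set (Set Ordinal.{0}), 𝒜 ⊆ ctblInf (Set.Iio lam.ord) →
        StatFam (Set.Iio lam.ord) 𝒜 →
        ∃ A : Set Ordinal.{0}, A ⊆ Set.Iio lam.ord ∧
          #A = Cardinal.aleph 1 ∧ Reflects 𝒜 A) :
    (∀ μ κ : Cardinal.{0}, ℵ₀ ≤ μ → μ.ord.cof < μ → ℵ₀ ≤ κ → κ < μ →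
      (κ < μ.ord.cof → covCf μ κ = Cardinal.lift.{1,0} μ) ∧
      (μ.ord.cof ≤ κ → covCf μ κ = Cardinal.lift.{1,0} (Order.succ μ))) ∧
    (∀ μ : Cardinal.{0}, ℵ₀ ≤ μ → μ.ord.cof < μ →
      covCf μ μ.ord.cof = Cardinal.lift.{1,0} (Order.succ μ)) := by
  have main : ∀ μ κ : Cardinal.{0}, ℵ₀ ≤ μ → μ.ord.cof < μ → ℵ₀ ≤ κ → κ < μ →
      (κ < μ.ord.cof → covCf μ κ = Cardinal.lift.{1,0} μ) ∧
      (μ.ord.cof ≤ κ → covCf μ κ = Cardinal.lift.{1,0} (Order.succ μ)) := by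
    intro μ κ _ _ hκ hκμ
    exact ⟨fun h => le_antisymm (covCf_le ((cov_main hrefl hκ μ).2 h)) (low1 hκ hκμ),
      fun h => le_antisymm (covCf_le (cov_main hrefl hκ μ).1) (low2 hκ hκμ h)⟩
  refine ⟨main, fun μ hμ hs => (main μ μ.ord.cof hμ hs ?_ hs).2 le_rfl⟩
  exact (isRegular_cof (isSuccLimit_ord hμ)).aleph0_le

end ReflSCH
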